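/- For each integer n > 0, the number of cubic pregraphs on n vertices having at least two pairwise non-isomorphic C4-quotient 2-factors is: 0 if n is odd; 4 if n ≡ 0 (mod 4) (the barbed path, the double-closed ladder, the double-open ladder, and the open-closed ladder on n vertices); and 2 if n ≡ 2 (mod 4) (the barbed path and the open-closed ladder on n vertices). -/

import Mathlib

/-- The possible "ends" of an edge in a pregraph: an ordinary edge (or loop)
with two endpoints, or a semi-edge with a single endpoint. -/
inductive PEnds (V : Type) where
  | edge : V → V → PEnds V
  | semi : V → PEnds V
  deriving DecidableEq

/-- A finite pregraph: a multigraph that may contain loops, parallel edges and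
semi-edges.  Edges are abstract and carry their endpoints via `ends`. -/
structure Pregraph where
  V : Type
  E : Type
  [fintypeV : Fintype V]
  [decEqV : DecidableEq V]
  [fintypeE : Fintype E]
  [decEqE : DecidableEq E]
  ends : E → PEnds V

attribute [instance] Pregraph.fintypeV Pregraph.decEqV Pregraph.fintypeE Pregraph.decEqE

namespace Pregraph

/-- The number of end-points that edge `e` has at the vertex `v`
(a loop at `v` counts twice, a semi-edge once). -/
def endCount (P : Pregraph) (v : P.V) (e : P.E) : ℕ :=
  match P.ends e with
  | .edge a b => (if a = v then 1 else 0) + (if b = v then 1 else 0)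
  | .semi a => if a = v then 1 else 0

/-- The degree of a vertex: loops count 2, semi-edges count 1. -/
def degree (P : Pregraph) (v : P.V) : ℕ := ∑ e : P.E, P.endCount v e

open Classical in
/-- The degree of a vertex inside a set `F` of edges. -/
noncomputable def degIn (P : Pregraph) (F : Set P.E) (v : P.V) : ℕ :=
  ∑ e : P.E, if e ∈ F then P.endCount v e else 0

/-- `e` is a proper edge with endpoints `a` and `b`. -/
def joins (P : Pregraph) (e : P.E) (a b : P.V) : Prop :=
  P.ends e = .edge a b ∨ P.ends e = .edge b a

/-- The edge `e` is incident to the vertex `v`. -/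
def incident (P : Pregraph) (e : P.E) (v : P.V) : Prop :=
  match P.ends e with
  | .edge a b => a = v ∨ b = v
  | .semi a => a = v

/-- Adjacency via a proper edge. -/
def Adj (P : Pregraph) (u w : P.V) : Prop := ∃ e, P.joins e u w

/-- Connectedness of a pregraph. -/
def Connected (P : Pregraph) : Prop := ∀ u w : P.V, Relation.ReflTransGen P.Adj u w

/-- A cubic pregraph: connected and every vertex has degree 3. -/
def Cubic (P : Pregraph) : Prop := P.Connected ∧ ∀ v, P.degree v = 3

/-- The edge `e` has at least one endpoint in the vertex set `C`. -/
def touches (P : Pregraph) (e : P.E) (C : Set P.V) : Prop :=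
  match P.ends e with
  | .edge a b => a ∈ C ∨ b ∈ C
  | .semi a => a ∈ C

/-- `C` is a component of the edge set `F` of type `q₁` : a 4-cycle. -/
def IsQ1Comp (P : Pregraph) (F : Set P.E) (C : Set P.V) : Prop :=
  ∃ a b c d : P.V, a ≠ b ∧ a ≠ c ∧ a ≠ d ∧ b ≠ c ∧ b ≠ d ∧ c ≠ d ∧
    C = {a, b, c, d} ∧
    ∃ e1 e2 e3 e4 : P.E, e1 ≠ e2 ∧ e1 ≠ e3 ∧ e1 ≠ e4 ∧ e2 ≠ e3 ∧ e2 ≠ e4 ∧ e3 ≠ e4 ∧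
      {e ∈ F | P.touches e C} = {e1, e2, e3, e4} ∧
      P.joins e1 a b ∧ P.joins e2 b c ∧ P.joins e3 c d ∧ P.joins e4 d a

/-- `C` is a component of the edge set `F` of type `q₂` : a digon. -/
def IsQ2Comp (P : Pregraph) (F : Set P.E) (C : Set P.V) : Prop :=
  ∃ a b : P.V, a ≠ b ∧ C = {a, b} ∧
    ∃ e1 e2 : P.E, e1 ≠ e2 ∧ {e ∈ F | P.touches e C} = {e1, e2} ∧
      P.joins e1 a b ∧ P.joins e2 a b

/-- `C` is a component of the edge set `F` of type `q₃` : an edge together with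
a semi-edge at each endpoint. -/
def IsQ3Comp (P : Pregraph) (F : Set P.E) (C : Set P.V) : Prop :=
  ∃ a b : P.V, a ≠ b ∧ C = {a, b} ∧
    ∃ e1 e2 e3 : P.E, e1 ≠ e2 ∧ e1 ≠ e3 ∧ e2 ≠ e3 ∧
      {e ∈ F | P.touches e C} = {e1, e2, e3} ∧
      P.joins e1 a b ∧ P.ends e2 = .semi a ∧ P.ends e3 = .semi b

/-- `C` is a component of the edge set `F` of type `q₄` : a single vertex with
two semi-edges. -/
def IsQ4Comp (P : Pregraph) (F : Set P.E) (C : Set P.V) : Prop :=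
  ∃ a : P.V, C = {a} ∧
    ∃ e1 e2 : P.E, e1 ≠ e2 ∧ {e ∈ F | P.touches e C} = {e1, e2} ∧
      P.ends e1 = .semi a ∧ P.ends e2 = .semi a

/-- `C` is a component of `F` which is a quotient of `C₄`. -/
def IsCQComp (P : Pregraph) (F : Set P.E) (C : Set P.V) : Prop :=
  P.IsQ1Comp F C ∨ P.IsQ2Comp F C ∨ P.IsQ3Comp F C ∨ P.IsQ4Comp F C

/-- `F` is a `C₄`-quotient 2-factor with component partition `Ps`. -/
def IsCQFactorWith (P : Pregraph) (F : Set P.E) (Ps : Set (Set P.V)) : Prop :=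
  (∀ C ∈ Ps, P.IsCQComp F C) ∧
  (∀ v : P.V, ∃ C ∈ Ps, v ∈ C) ∧
  (∀ C ∈ Ps, ∀ D ∈ Ps, C ≠ D → Disjoint C D)

/-- `F` is a `C₄`-quotient 2-factor: a spanning subgraph in which every vertex has
degree 2 and every component is a quotient of `C₄`. -/
def IsCQFactor (P : Pregraph) (F : Set P.E) : Prop := ∃ Ps, P.IsCQFactorWith F Ps

/-- The pregraph has a `C₄`-quotient 2-factor. -/
def HasCQFactor (P : Pregraph) : Prop := ∃ F, P.IsCQFactor F

/-- Compatibility of ends under a vertex map (edges are unordered). -/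
def endsRel {V W : Type} (σ : V → W) : PEnds V → PEnds W → Prop
  | .edge a b, x => x = .edge (σ a) (σ b) ∨ x = .edge (σ b) (σ a)
  | .semi a, x => x = .semi (σ a)

/-- An isomorphism of pregraphs. -/
structure Iso (P Q : Pregraph) where
  vmap : P.V ≃ Q.V
  emap : P.E ≃ Q.E
  compat : ∀ e, endsRel vmap (P.ends e) (Q.ends (emap e))

/-- Two edge sets (e.g. two 2-factors) of `P` are isomorphic if some automorphism
of `P` maps one onto the other. -/
def FactorIso (P : Pregraph) (F1 F2 : Set P.E) : Prop :=
  ∃ φ : Iso P P, ∀ e, e ∈ F1 ↔ φ.emap e ∈ F2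

/-- Adjacency in the ladder graph `K₂ × Pₙ` on `Fin n × Fin 2`. -/
def ladderAdj (n : ℕ) (p q : Fin n × Fin 2) : Prop :=
  (p.1 = q.1 ∧ p.2 ≠ q.2) ∨ (p.2 = q.2 ∧ ((p.1 : ℕ) + 1 = q.1 ∨ (q.1 : ℕ) + 1 = p.1))

/-- The subgraph of `P` with vertex set `S` and edge set `F` is isomorphic to the
ladder `K₂ × Pₙ` for some `n ≥ 2`. -/
def IsLadder (P : Pregraph) (S : Set P.V) (F : Set P.E) : Prop :=
  ∃ n : ℕ, 2 ≤ n ∧ ∃ f : Fin n × Fin 2 → P.V, Function.Injective f ∧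
    S = Set.range f ∧
    (∀ e ∈ F, ∃ p q, ladderAdj n p q ∧ P.joins e (f p) (f q)) ∧
    (∀ p q, ladderAdj n p q → ∃! e, e ∈ F ∧ P.joins e (f p) (f q))

/-- A ladder of `P`: a maximal subgraph isomorphic to `K₂ × Pₙ`, `n ≥ 2`. -/
def IsMaxLadder (P : Pregraph) (S : Set P.V) (F : Set P.E) : Prop :=
  P.IsLadder S F ∧
  ∀ S' F', P.IsLadder S' F' → S ⊆ S' → F ⊆ F' → S = S' ∧ F = F'

/-- A digon: two distinct vertices joined by two parallel edges. -/
def IsDigonPair (P : Pregraph) (a b : P.V) : Prop :=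
  a ≠ b ∧ ∃ e1 e2 : P.E, e1 ≠ e2 ∧ P.joins e1 a b ∧ P.joins e2 a b

end Pregraph

/-- The barbed path on `n` vertices. -/
def barbedPath (n : ℕ) [NeZero n] : Pregraph where
  V := Fin n
  E := Fin (n - 1) ⊕ (Fin n ⊕ Fin 2)
  ends := fun e =>
    match e with
    | .inl i => .edge ⟨i.1, by have := i.2; omega⟩ ⟨i.1 + 1, by have := i.2; omega⟩
    | .inr (.inl v) => .semi v
    | .inr (.inr j) =>
        if j = 0 then
          .semi ⟨0, Nat.pos_of_ne_zero (NeZero.ne n)⟩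
        else
          .semi ⟨n - 1, by have := Nat.pos_of_ne_zero (NeZero.ne n); omega⟩

/-- The double-closed ladder on `2 * m` vertices: `K₂ × Pₘ` with the two vertex
pairs at the ends each joined by an extra parallel edge. -/
def dcLadder (m : ℕ) [NeZero m] : Pregraph where
  V := Fin m × Fin 2
  E := (Fin (m - 1) × Fin 2) ⊕ (Fin m ⊕ Fin 2)
  ends := fun e =>
    match e with
    | .inl (i, j) =>
        .edge (⟨i.1, by have := i.2; omega⟩, j) (⟨i.1 + 1, by have := i.2; omega⟩, j)
    | .inr (.inl i) => .edge (i, 0) (i, 1)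
    | .inr (.inr k) =>
        if k = 0 then
          .edge (⟨0, Nat.pos_of_ne_zero (NeZero.ne m)⟩, 0)
               (⟨0, Nat.pos_of_ne_zero (NeZero.ne m)⟩, 1)
        else
          .edge (⟨m - 1, by have := Nat.pos_of_ne_zero (NeZero.ne m); omega⟩, 0)
               (⟨m - 1, by have := Nat.pos_of_ne_zero (NeZero.ne m); omega⟩, 1)

/-- The double-open ladder on `2 * m` vertices: `K₂ × Pₘ` with a semi-edge at each
of the four end vertices. -/
def doLadder (m : ℕ) [NeZero m] : Pregraph where
  V := Fin m × Fin 2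
  E := (Fin (m - 1) × Fin 2) ⊕ (Fin m ⊕ (Fin 2 × Fin 2))
  ends := fun e =>
    match e with
    | .inl (i, j) =>
        .edge (⟨i.1, by have := i.2; omega⟩, j) (⟨i.1 + 1, by have := i.2; omega⟩, j)
    | .inr (.inl i) => .edge (i, 0) (i, 1)
    | .inr (.inr (k, j)) =>
        if k = 0 then
          .semi (⟨0, Nat.pos_of_ne_zero (NeZero.ne m)⟩, j)
        else
          .semi (⟨m - 1, by have := Nat.pos_of_ne_zero (NeZero.ne m); omega⟩, j)

/-- The open-closed ladder on `2 * m` vertices: `K₂ × Pₘ` with an extra parallel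
edge joining the end pair on one side and a semi-edge at each of the two end
vertices on the other side. -/
def ocLadder (m : ℕ) [NeZero m] : Pregraph where
  V := Fin m × Fin 2
  E := (Fin (m - 1) × Fin 2) ⊕ (Fin m ⊕ (Unit ⊕ Fin 2))
  ends := fun e =>
    match e with
    | .inl (i, j) =>
        .edge (⟨i.1, by have := i.2; omega⟩, j) (⟨i.1 + 1, by have := i.2; omega⟩, j)
    | .inr (.inl i) => .edge (i, 0) (i, 1)
    | .inr (.inr (.inl _)) =>
        .edge (⟨0, Nat.pos_of_ne_zero (NeZero.ne m)⟩, 0)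
             (⟨0, Nat.pos_of_ne_zero (NeZero.ne m)⟩, 1)
    | .inr (.inr (.inr j)) =>
        .semi (⟨m - 1, by have := Nat.pos_of_ne_zero (NeZero.ne m); omega⟩, j)

/-- `P` has (at least) two pairwise non-isomorphic `C₄`-quotient 2-factors. -/
def HasMultipleCQFactors (P : Pregraph) : Prop :=
  ∃ F1 F2 : Set P.E, P.IsCQFactor F1 ∧ P.IsCQFactor F2 ∧ ¬ Pregraph.FactorIso P F1 F2

namespace Pregraph

/-- A proper 3-edge-colouring of a pregraph, with the associated involutions. -/
structure TriCol (P : Pregraph) where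
  col : P.E → Fin 3
  ed : P.V → Fin 3 → P.E
  τ : Fin 3 → P.V → P.V
  col_ed : ∀ v i, col (ed v i) = i
  uniq : ∀ e v, P.incident e v → e = ed v (col e)
  ends_ed : ∀ v i, (τ i v = v ∧ P.ends (ed v i) = .semi v) ∨
    (τ i v ≠ v ∧ P.joins (ed v i) v (τ i v))

theorem joins_comm {P : Pregraph} {e : P.E} {a b : P.V} (h : P.joins e a b) : P.joins e b a :=
  Or.symm h

theorem incident_of_joins {P : Pregraph} {e : P.E} {a b : P.V} (h : P.joins e a b) :
    P.incident e a := by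
  rcases h with h | h <;> simp [incident, h]

theorem incident_of_semi {P : Pregraph} {e : P.E} {a : P.V} (h : P.ends e = .semi a) :
    P.incident e a := by
  simp [incident, h]

theorem exists_incident {P : Pregraph} (e : P.E) : ∃ v, P.incident e v := by
  rcases h : P.ends e with ⟨a, b⟩ | a
  · exact ⟨a, by simp [incident, h]⟩
  · exact ⟨a, by simp [incident, h]⟩

theorem eq_of_incident_semi {P : Pregraph} {e : P.E} {a v : P.V} (h : P.ends e = .semi a)
    (hv : P.incident e v) : a = v := by
  simpa [incident, h] using hv

theorem eq_of_incident_joins {P : Pregraph} {e : P.E} {a b v : P.V} (h : P.joins e a b)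
    (hv : P.incident e v) : v = a ∨ v = b := by
  rcases h with h | h <;> simp [incident, h] at hv <;> grind

theorem touches_iff {P : Pregraph} {e : P.E} {C : Set P.V} :
    P.touches e C ↔ ∃ v ∈ C, P.incident e v := by
  unfold touches incident
  rcases h : P.ends e with ⟨a, b⟩ | a <;> simp only
  · constructor
    · rintro (h | h)
      · exact ⟨a, h, Or.inl rfl⟩
      · exact ⟨b, h, Or.inr rfl⟩
    · rintro ⟨v, hv, rfl | rfl⟩
      · exact Or.inl hv
      · exact Or.inr hv
  · simp

theorem joins_right_unique {P : Pregraph} {e : P.E} {a b c : P.V} (h : P.joins e a b)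
    (h' : P.joins e a c) : b = c := by
  unfold joins at h h'; grind

namespace TriCol

variable {P : Pregraph} (T : TriCol P)

theorem inc_ed (v : P.V) (i : Fin 3) : P.incident (T.ed v i) v := by
  rcases T.ends_ed v i with ⟨_, h⟩ | ⟨_, h⟩
  · exact incident_of_semi h
  · exact incident_of_joins h

theorem inc_ed_iff (v w : P.V) (i : Fin 3) :
    P.incident (T.ed v i) w ↔ w = v ∨ w = T.τ i v := by
  constructor
  · intro hw
    rcases T.ends_ed v i with ⟨_, h⟩ | ⟨_, h⟩
    · exact Or.inl (eq_of_incident_semi h hw).symm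
    · exact eq_of_incident_joins h hw
  · rintro (rfl | rfl)
    · exact T.inc_ed _ _
    · rcases T.ends_ed v i with ⟨h1, h⟩ | ⟨_, h⟩
      · rw [h1]; exact T.inc_ed _ _
      · exact incident_of_joins (joins_comm h)

theorem ed_eq_iff (v w : P.V) (i j : Fin 3) :
    T.ed v i = T.ed w j ↔ i = j ∧ (w = v ∨ w = T.τ i v) := by
  constructor
  · intro h
    have hij : i = j := by rw [← T.col_ed v i, h, T.col_ed]
    subst hij
    refine ⟨rfl, ?_⟩
    rw [← inc_ed_iff, h]; exact T.inc_ed _ _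
  · rintro ⟨rfl, h⟩
    rw [← inc_ed_iff] at h
    have := T.uniq _ _ h
    rwa [T.col_ed] at this

theorem ed_τ (v : P.V) (i : Fin 3) : T.ed (T.τ i v) i = T.ed v i :=
  ((T.ed_eq_iff _ _ _ _).2 ⟨rfl, Or.inr rfl⟩).symm

@[simp] theorem τ_τ (i : Fin 3) (v : P.V) : T.τ i (T.τ i v) = v := by
  by_cases h : T.τ i v = v
  · rw [h, h]
  · have := (T.ed_eq_iff (T.τ i v) v i i).1 (T.ed_τ v i)
    rcases this.2 with h1 | h1
    · exact absurd h1.symm h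
    · exact h1.symm

theorem surj (e : P.E) : ∃ v, e = T.ed v (T.col e) := by
  obtain ⟨v, hv⟩ := exists_incident e
  exact ⟨v, T.uniq _ _ hv⟩

theorem τ_inj (i : Fin 3) {u v : P.V} (h : T.τ i u = T.τ i v) : u = v := by
  rw [← T.τ_τ i u, h, T.τ_τ]

/-- Isomorphism from an equivariant bijection. -/
theorem exists_iso {P Q : Pregraph} (T : TriCol P) (S : TriCol Q) (σ : P.V ≃ Q.V)
    (h : ∀ i v, σ (T.τ i v) = S.τ i (σ v)) :
    ∃ φ : Iso P Q, (∀ v, φ.vmap v = σ v) ∧ ∀ e, S.col (φ.emap e) = T.col e := by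
  choose p hp using T.surj
  choose q hq using S.surj
  let f : P.E → Q.E := fun e => S.ed (σ (p e)) (T.col e)
  let g : Q.E → P.E := fun e => T.ed (σ.symm (q e)) (S.col e)
  have hf : ∀ v i, f (T.ed v i) = S.ed (σ v) i := by
    intro v i
    have h1 := hp (T.ed v i)
    rw [T.col_ed, T.ed_eq_iff] at h1
    simp only [f, T.col_ed]
    rw [S.ed_eq_iff]
    refine ⟨rfl, ?_⟩
    rcases h1.2 with h2 | h2
    · left; rw [h2]
    · right; rw [h2, ← h]; simp
  have h' : ∀ i v, σ.symm (S.τ i v) = T.τ i (σ.symm v) := by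
    intro i v
    rw [Equiv.symm_apply_eq, h]; simp
  have hg : ∀ v i, g (S.ed v i) = T.ed (σ.symm v) i := by
    intro v i
    have h1 := hq (S.ed v i)
    rw [S.col_ed, S.ed_eq_iff] at h1
    simp only [g, S.col_ed]
    rw [T.ed_eq_iff]
    refine ⟨rfl, ?_⟩
    rcases h1.2 with h2 | h2
    · left; rw [h2]
    · right; rw [h2, ← h']; simp
  refine ⟨⟨σ, ⟨f, g, ?_, ?_⟩, ?_⟩, fun _ => rfl, ?_⟩
  · intro e
    obtain ⟨v, hv⟩ := T.surj e
    rw [hv, hf, hg]; simp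
  · intro e
    obtain ⟨v, hv⟩ := S.surj e
    rw [hv, hg, hf]; simp
  · intro e
    obtain ⟨v, hv⟩ := T.surj e
    rw [hv]
    change endsRel σ _ (Q.ends (f _))
    rw [hf]
    rcases T.ends_ed v (T.col e) with ⟨h1, h2⟩ | ⟨h1, h2⟩
    · rw [h2]
      rcases S.ends_ed (σ v) (T.col e) with ⟨h3, h4⟩ | ⟨h3, h4⟩
      · exact h4
      · rw [← h, h1] at h3; exact absurd rfl h3
    · rcases S.ends_ed (σ v) (T.col e) with ⟨h3, h4⟩ | ⟨h3, h4⟩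
      · rw [← h] at h3; exact absurd (σ.injective h3) h1
      · rw [← h] at h4
        rcases h2 with h2 | h2 <;> rw [h2]
        · exact h4
        · exact h4.symm
  · intro e
    change S.col (f e) = _
    simp only [f, S.col_ed]

/-- Permuting the first two colours. -/
def swp (i : Fin 3) : Fin 3 := if i = 0 then 1 else if i = 1 then 0 else 2

@[simp] theorem swp_swp (i : Fin 3) : swp (swp i) = i := by
  revert i; decide

def swap : TriCol P where
  col e := swp (T.col e)
  ed v i := T.ed v (swp i)
  τ i v := T.τ (swp i) v
  col_ed v i := by rw [T.col_ed, swp_swp]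
  uniq e v h := by rw [swp_swp]; exact T.uniq e v h
  ends_ed v i := T.ends_ed v (swp i)

/-- The edge set avoiding one colour. -/
def avoid (j : Fin 3) : Set P.E := {e | T.col e ≠ j}

theorem factorIso_of_equiv (σ : P.V ≃ P.V) (h : ∀ i v, σ (T.τ i v) = T.τ (swp i) (σ v)) :
    P.FactorIso (T.avoid 0) (T.avoid 1) := by
  obtain ⟨φ, _, h2⟩ := exists_iso T T.swap σ h
  refine ⟨φ, fun e => ?_⟩
  have := h2 e
  simp only [swap] at this
  simp only [avoid, Set.mem_setOf_eq]
  rw [← this]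
  generalize T.col (φ.emap e) = i
  revert i; decide

/-- Transport along an isomorphism. -/
theorem exists_transport {P Q : Pregraph} (φ : Iso P Q) (S : TriCol Q) :
    ∃ T : TriCol P, ∀ i v, φ.vmap (T.τ i v) = S.τ i (φ.vmap v) := by
  have key : ∀ e v, P.incident e v → Q.incident (φ.emap e) (φ.vmap v) := by
    intro e v
    have hc := φ.compat e
    unfold incident
    rcases h : P.ends e with ⟨a, b⟩ | a <;> rw [h] at hc <;> simp only [endsRel] at hc
    · rcases hc with hc | hc <;> rw [hc] <;> simp only <;> rintro (rfl | rfl) <;> simp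
    · rw [hc]; simp only; rintro rfl; rfl
  refine ⟨{ col := fun e => S.col (φ.emap e)
            ed := fun v i => φ.emap.symm (S.ed (φ.vmap v) i)
            τ := fun i v => φ.vmap.symm (S.τ i (φ.vmap v))
            col_ed := by intro v i; simp [S.col_ed]
            uniq := ?_
            ends_ed := ?_ }, by intro i v; simp⟩
  · intro e v h
    rw [Equiv.eq_symm_apply]
    exact S.uniq _ _ (key e v h)
  · intro v i
    have hc := φ.compat (φ.emap.symm (S.ed (φ.vmap v) i))
    rw [Equiv.apply_symm_apply] at hc
    rw [Equiv.symm_apply_eq, Ne, Equiv.symm_apply_eq]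
    rcases S.ends_ed (φ.vmap v) i with ⟨h1, h2⟩ | ⟨h1, h2⟩
    · left
      refine ⟨h1, ?_⟩
      rw [h2] at hc
      rcases h : P.ends (φ.emap.symm (S.ed (φ.vmap v) i)) with ⟨a, b⟩ | a <;> rw [h] at hc <;>
        simp only [endsRel] at hc
      · simp at hc
      · simpa using hc.symm
    · right
      refine ⟨h1, ?_⟩
      unfold joins at h2 ⊢
      rcases h : P.ends (φ.emap.symm (S.ed (φ.vmap v) i)) with ⟨a, b⟩ | a <;> rw [h] at hc <;>
        simp only [endsRel] at hc
      · have e1 : ∀ x : P.V, ∀ y, φ.vmap x = y ↔ x = φ.vmap.symm y := by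
          intro x y; rw [Equiv.eq_symm_apply]
        rcases h2 with h2 | h2 <;> rcases hc with hc | hc <;> rw [h2] at hc <;>
          simp only [PEnds.edge.injEq] at hc ⊢ <;> obtain ⟨h3, h4⟩ := hc
        · left; exact ⟨(φ.vmap.injective h3).symm, by rw [h4]; simp⟩
        · right; exact ⟨by rw [h4]; simp, (φ.vmap.injective h3).symm⟩
        · right; exact ⟨by rw [h3]; simp, (φ.vmap.injective h4).symm⟩
        · left; exact ⟨(φ.vmap.injective h4).symm, by rw [h3]; simp⟩
      · rw [hc] at h2; simp at h2

end TriCol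
end Pregraph

namespace Pregraph
namespace TriCol

variable {P : Pregraph} (T : TriCol P)

/-- Orbit of the group generated by two commuting involutions. -/
def orb (i : Fin 3) (v : P.V) : Set P.V := {v, T.τ i v, T.τ 2 v, T.τ i (T.τ 2 v)}

theorem mem_touch {i j : Fin 3} (hj : ∀ k : Fin 3, k ≠ j ↔ k = i ∨ k = 2) (C : Set P.V) (e : P.E) :
    e ∈ {e ∈ T.avoid j | P.touches e C} ↔ ∃ v ∈ C, e = T.ed v i ∨ e = T.ed v 2 := by
  simp only [avoid, Set.mem_ofPred_eq, touches_iff]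
  rw [hj]
  constructor
  · rintro ⟨h, v, hv, hi⟩
    refine ⟨v, hv, ?_⟩
    have := T.uniq _ _ hi
    rcases h with h | h <;> rw [h] at this <;> simp [← this]
  · rintro ⟨v, hv, rfl | rfl⟩
    · exact ⟨Or.inl (T.col_ed _ _), v, hv, T.inc_ed _ _⟩
    · exact ⟨Or.inr (T.col_ed _ _), v, hv, T.inc_ed _ _⟩

theorem joins_ed {v : P.V} {i : Fin 3} (h : T.τ i v ≠ v) : P.joins (T.ed v i) v (T.τ i v) := by
  rcases T.ends_ed v i with h' | h'
  · exact absurd h'.1 h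
  · exact h'.2

theorem semi_ed {v : P.V} {i : Fin 3} (h : T.τ i v = v) : P.ends (T.ed v i) = .semi v := by
  rcases T.ends_ed v i with h' | h'
  · exact h'.2
  · exact absurd h h'.1

theorem isCQFactor {i j : Fin 3} (hj : ∀ k : Fin 3, k ≠ j ↔ k = i ∨ k = 2) (hi : i ≠ 2)
    (hc : ∀ v, T.τ i (T.τ 2 v) = T.τ 2 (T.τ i v)) : P.IsCQFactor (T.avoid j) := by
  refine ⟨Set.range (T.orb i), ?_, fun v => ⟨T.orb i v, ⟨v, rfl⟩, by simp [orb]⟩, ?_⟩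
  · rintro _ ⟨v, rfl⟩
    have mt := T.mem_touch hj (T.orb i v)
    have hne := fun v w => T.ed_eq_iff v w i 2
    by_cases hX : T.τ i v = v
    · by_cases hR : T.τ 2 v = v
      · right; right; right
        refine ⟨v, by simp [orb, hX, hR], T.ed v i, T.ed v 2, ?_, ?_, T.semi_ed hX, T.semi_ed hR⟩
        · rw [Ne, hne]; exact fun h => hi h.1
        · ext e; rw [mt]; simp [orb, hX, hR]
      · right; right; left
        have hX' : T.τ i (T.τ 2 v) = T.τ 2 v := by rw [hc, hX]
        refine ⟨v, T.τ 2 v, fun h => hR h.symm, by simp [orb, hX, hX'], T.ed v 2, T.ed v i,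
          T.ed (T.τ 2 v) i, ?_, ?_, ?_, ?_, T.joins_ed hR, T.semi_ed hX, T.semi_ed hX'⟩
        · rw [ne_comm, Ne, hne]; exact fun h => hi h.1
        · rw [ne_comm, Ne, hne]; exact fun h => hi h.1
        · rw [Ne, T.ed_eq_iff]; grind
        · ext e; rw [mt]; simp [orb, hX, hX', T.ed_τ]; tauto
    · by_cases hR : T.τ 2 v = v
      · right; right; left
        have hR' : T.τ 2 (T.τ i v) = T.τ i v := by rw [← hc, hR]
        refine ⟨v, T.τ i v, fun h => hX h.symm, ?_, T.ed v i, T.ed v 2,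
          T.ed (T.τ i v) 2, ?_, ?_, ?_, ?_, T.joins_ed hX, T.semi_ed hR, T.semi_ed hR'⟩
        · ext x; simp [orb, hR]
        · rw [Ne, hne]; exact fun h => hi h.1
        · rw [Ne, hne]; exact fun h => hi h.1
        · rw [Ne, T.ed_eq_iff]; grind
        · ext e; rw [mt]; simp [orb, hR, T.ed_τ]; tauto
      · by_cases hXR : T.τ i v = T.τ 2 v
        · right; left
          refine ⟨v, T.τ 2 v, fun h => hR h.symm, ?_, T.ed v i, T.ed v 2, ?_, ?_,
            hXR ▸ T.joins_ed hX, T.joins_ed hR⟩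
          · ext x; simp [orb, ← hXR]; tauto
          · rw [Ne, hne]; exact fun h => hi h.1
          · ext e; rw [mt]
            have h1 := T.ed_τ v i
            have h2 := T.ed_τ v 2
            rw [hXR] at h1
            simp [orb, hXR, hc, h1, h2]
        · left
          have h1 : T.τ i (T.τ 2 v) ≠ v := by
            intro h; apply hXR; rw [← T.τ_τ i (T.τ 2 v), h]
          have h2 : T.τ i (T.τ 2 v) ≠ T.τ 2 v := by
            intro h; rw [hc] at h; exact hX (T.τ_inj _ h)
          have h3 : T.τ 2 (T.τ i v) ≠ T.τ i v := by
            intro h; rw [← hc] at h; exact hR (T.τ_inj _ h)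
          have e3 : T.ed (T.τ i (T.τ 2 v)) 2 = T.ed (T.τ i v) 2 := by rw [hc, T.ed_τ]
          refine ⟨v, T.τ i v, T.τ i (T.τ 2 v), T.τ 2 v, Ne.symm hX, Ne.symm h1, Ne.symm hR,
            ?_, hXR, h2, ?_, T.ed v i, T.ed (T.τ i v) 2, T.ed (T.τ 2 v) i, T.ed v 2,
            ?_, ?_, ?_, ?_, ?_, ?_, ?_, T.joins_ed hX, ?_, joins_comm (T.joins_ed h2),
            joins_comm (T.joins_ed hR)⟩
          · rw [hc]; exact h3.symm
          · ext x; simp [orb]; tauto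
          · rw [Ne, hne]; exact fun h => hi h.1
          · rw [Ne, T.ed_eq_iff]; grind
          · rw [Ne, hne]; exact fun h => hi h.1
          · rw [ne_comm, Ne, hne]; exact fun h => hi h.1
          · rw [Ne, T.ed_eq_iff, ← hc]; grind
          · rw [Ne, hne]; exact fun h => hi h.1
          · ext e; rw [mt]; simp [orb, T.ed_τ, e3]; tauto
          · rw [hc]; exact T.joins_ed h3
  · rintro _ ⟨v, rfl⟩ _ ⟨w, rfl⟩ hne
    rw [Set.disjoint_left]
    intro x hx hy
    apply hne
    have key : ∀ v, x ∈ T.orb i v → T.orb i x = T.orb i v := by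
      intro v hv
      simp only [orb, Set.mem_insert_iff, Set.mem_singleton_iff] at hv
      rcases hv with rfl | rfl | rfl | rfl <;> ext y <;> simp [orb, ← hc] <;> tauto
    rw [← key v hx, key w hy]

theorem not_factorIso_twin (h1 : ∃ v, T.τ 1 v = T.τ 2 v) (h0 : ∀ v, T.τ 0 v ≠ T.τ 2 v) :
    ¬ P.FactorIso (T.avoid 0) (T.avoid 1) := by
  rintro ⟨φ, hφ⟩
  obtain ⟨v, hv⟩ := h1
  have key : ∀ e f : P.E, ∀ u, P.incident e u → P.incident f u → e ∈ T.avoid 1 → f ∈ T.avoid 1 →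
      (∀ w, P.incident e w ↔ P.incident f w) → e = f := by
    intro e f u he hf h1 h2 hw
    have h3 := T.uniq _ _ he
    have h4 := T.uniq _ _ hf
    simp only [avoid, Set.mem_ofPred_eq] at h1 h2
    by_contra hef
    have h5 : T.col e ≠ T.col f := by
      intro h; rw [h, ← h4] at h3; exact hef h3
    rw [h3, h4] at hw
    simp only [inc_ed_iff] at hw
    have h6 : T.τ (T.col e) u = T.τ (T.col f) u := by
      have a1 := hw (T.τ (T.col e) u)
      have a2 := hw (T.τ (T.col f) u)
      grind
    have := h0 u
    generalize T.col e = i at *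
    generalize T.col f = j at *
    fin_cases i <;> fin_cases j <;> simp at * <;> simp_all
  have e1 : T.ed v 1 ∈ T.avoid 0 := by simp [avoid, T.col_ed]
  have e2 : T.ed v 2 ∈ T.avoid 0 := by simp [avoid, T.col_ed]
  rw [hφ] at e1 e2
  have inc : ∀ e w, P.incident e w ↔ P.incident (φ.emap e) (φ.vmap w) := by
    intro e w
    have hc := φ.compat e
    unfold incident
    rcases h : P.ends e with ⟨a, b⟩ | a <;> rw [h] at hc <;> simp only [endsRel] at hc
    · rcases hc with hc | hc <;> rw [hc] <;> simp; tauto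
    · rw [hc]; simp
  have := key _ _ (φ.vmap v) ((inc _ _).1 (T.inc_ed v 1)) ((inc _ _).1 (T.inc_ed v 2)) e1 e2 ?_
  · have := φ.emap.injective this
    rw [T.ed_eq_iff] at this
    exact absurd this.1 (by decide)
  · intro w
    obtain ⟨w, rfl⟩ := φ.vmap.surjective w
    rw [← inc, ← inc, inc_ed_iff, inc_ed_iff, hv]

theorem not_factorIso_semi (h1 : ∃ v, T.τ 1 v = v) (h0 : ∀ v, T.τ 0 v ≠ v)
    (h2 : ∀ v, T.τ 2 v ≠ v) :
    ¬ P.FactorIso (T.avoid 0) (T.avoid 1) := by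
  rintro ⟨φ, hφ⟩
  obtain ⟨v, hv⟩ := h1
  have e1 : T.ed v 1 ∈ T.avoid 0 := by simp [avoid, T.col_ed]
  rw [hφ] at e1
  have hc := φ.compat (T.ed v 1)
  rw [T.semi_ed hv] at hc
  simp only [endsRel] at hc
  have h3 := T.uniq _ _ (incident_of_semi hc)
  have h4 := T.ends_ed (φ.vmap v) (T.col (φ.emap (T.ed v 1)))
  rw [← h3] at h4
  simp only [avoid, Set.mem_ofPred_eq] at e1
  generalize T.col (φ.emap (T.ed v 1)) = i at *
  rcases h4 with ⟨h4, _⟩ | ⟨_, h4⟩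
  · have a := h0 (φ.vmap v)
    have b := h2 (φ.vmap v)
    fin_cases i <;> simp at * <;> simp_all
  · rcases h4 with h4 | h4 <;> rw [hc] at h4 <;> simp at h4

theorem multiple (hX : ∀ v, T.τ 0 (T.τ 2 v) = T.τ 2 (T.τ 0 v))
    (hY : ∀ v, T.τ 1 (T.τ 2 v) = T.τ 2 (T.τ 1 v))
    (h : ((∃ v, T.τ 1 v = T.τ 2 v) ∧ (∀ v, T.τ 0 v ≠ T.τ 2 v)) ∨
      ((∃ v, T.τ 1 v = v) ∧ (∀ v, T.τ 0 v ≠ v) ∧ (∀ v, T.τ 2 v ≠ v))) :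
    HasMultipleCQFactors P := by
  refine ⟨T.avoid 0, T.avoid 1, T.isCQFactor (i := 1) (by decide) (by decide) hY,
    T.isCQFactor (i := 0) (by decide) (by decide) hX, ?_⟩
  rcases h with ⟨h1, h2⟩ | ⟨h1, h2, h3⟩
  · exact T.not_factorIso_twin h1 h2
  · exact T.not_factorIso_semi h1 h2 h3

theorem multiple_of_iso {P Q : Pregraph} (φ : Iso P Q) (S : TriCol Q)
    (hX : ∀ v, S.τ 0 (S.τ 2 v) = S.τ 2 (S.τ 0 v))
    (hY : ∀ v, S.τ 1 (S.τ 2 v) = S.τ 2 (S.τ 1 v))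
    (h : ((∃ v, S.τ 1 v = S.τ 2 v) ∧ (∀ v, S.τ 0 v ≠ S.τ 2 v)) ∨
      ((∃ v, S.τ 1 v = v) ∧ (∀ v, S.τ 0 v ≠ v) ∧ (∀ v, S.τ 2 v ≠ v))) :
    HasMultipleCQFactors P := by
  obtain ⟨T, hT⟩ := exists_transport φ S
  have hex : ∀ p : Q.V → Prop, (∃ v, p v) → ∃ v, p (φ.vmap v) := by
    rintro p ⟨v, hv⟩; exact ⟨φ.vmap.symm v, by simpa using hv⟩
  have heq : ∀ u v, u = v ↔ φ.vmap u = φ.vmap v := fun u v => φ.vmap.injective.eq_iff.symm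
  refine T.multiple (fun v => ?_) (fun v => ?_) ?_
  · rw [heq, hT, hT, hT, hT, hX]
  · rw [heq, hT, hT, hT, hT, hY]
  · rcases h with ⟨h1, h2⟩ | ⟨h1, h2, h3⟩
    · left
      obtain ⟨v, hv⟩ := hex _ h1
      exact ⟨⟨v, by rw [heq, hT, hT, hv]⟩, fun v => by rw [Ne, heq, hT, hT]; exact h2 _⟩
    · right
      obtain ⟨v, hv⟩ := hex _ h1
      exact ⟨⟨v, by rw [heq, hT, hv]⟩, fun v => by rw [Ne, heq, hT]; exact h2 _,
        fun v => by rw [Ne, heq, hT]; exact h3 _⟩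

end TriCol
end Pregraph

namespace Pregraph
namespace TriCol

/-- The abstract model: a chain of `m` rungs of shape `B`. -/
def mdl (m : ℕ) {B : Type} (ρ s t : B → B) (i : Fin 3) (p : Fin m × B) : Fin m × B :=
  if i = 2 then (p.1, ρ p.2)
  else if p.1.val % 2 = i.val then
    (if h : p.1.val + 1 < m then (⟨p.1.val + 1, h⟩, p.2) else (p.1, t p.2))
  else
    (if 0 < p.1.val then (⟨p.1.val - 1, by omega⟩, p.2) else (p.1, s p.2))

theorem mkTri (P : Pregraph) (m : ℕ) (hm : 0 < m) {B : Type} (ρ s t : B → B)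
    (vv : Fin m × B ≃ P.V)
    (rail : ∀ k, k + 1 < m → B → P.E) (rung : Fin m → B → P.E) (st en : B → P.E)
    (col : P.E → Fin 3)
    (hrail : ∀ k h b, P.ends (rail k h b) =
      .edge (vv (⟨k, by omega⟩, b)) (vv (⟨k + 1, h⟩, b)))
    (hrung : ∀ k b, (ρ b = b ∧ P.ends (rung k b) = .semi (vv (k, b))) ∨
      (ρ b ≠ b ∧ P.joins (rung k b) (vv (k, b)) (vv (k, ρ b))))
    (hst : ∀ b, (s b = b ∧ P.ends (st b) = .semi (vv (⟨0, hm⟩, b))) ∨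
      (s b ≠ b ∧ P.joins (st b) (vv (⟨0, hm⟩, b)) (vv (⟨0, hm⟩, s b))))
    (hen : ∀ b, (t b = b ∧ P.ends (en b) = .semi (vv (⟨m - 1, by omega⟩, b))) ∨
      (t b ≠ b ∧ P.joins (en b) (vv (⟨m - 1, by omega⟩, b)) (vv (⟨m - 1, by omega⟩, t b))))
    (hall : ∀ e, (∃ k h b, e = rail k h b) ∨ (∃ k b, e = rung k b) ∨
      (∃ b, e = st b) ∨ (∃ b, e = en b))
    (crail : ∀ k h b, (col (rail k h b)).val = k % 2)
    (crung : ∀ k b, col (rung k b) = 2)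
    (cst : ∀ b, col (st b) = 1)
    (cen : ∀ b, (col (en b)).val = (m - 1) % 2)
    (irung : ∀ k b, rung k (ρ b) = rung k b)
    (ist : ∀ b, st (s b) = st b)
    (ien : ∀ b, en (t b) = en b) :
    ∃ T : TriCol P, ∀ i p, T.τ i (vv p) = vv (mdl m ρ s t i p) := by
  let edm : Fin m × B → Fin 3 → P.E := fun p i =>
    if i = 2 then rung p.1 p.2
    else if p.1.val % 2 = i.val then
      (if h : p.1.val + 1 < m then rail p.1.val h p.2 else en p.2)
    else
      (if h : 0 < p.1.val then rail (p.1.val - 1) (by omega) p.2 else st p.2)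
  have hu : ∀ e p, P.incident e (vv p) → e = edm p (col e) := by
    intro e p hp
    rcases hall e with ⟨k, h, b, rfl⟩ | ⟨k, b, rfl⟩ | ⟨b, rfl⟩ | ⟨b, rfl⟩
    · have h2 : col (rail k h b) ≠ 2 := by
        intro h2; have := crail k h b; rw [h2] at this; simp at this; omega
      have h3 := eq_of_incident_joins (Or.inl (hrail k h b)) hp
      simp only [vv.injective.eq_iff] at h3
      simp only [edm, if_neg h2, crail]
      rcases h3 with rfl | rfl
      · simp [h]
      · rw [if_neg (by simp; omega)]; simp
    · simp only [edm, crung, if_true]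
      rcases hrung k b with ⟨h1, h2⟩ | ⟨h1, h2⟩
      · have := eq_of_incident_semi h2 hp
        rw [vv.injective.eq_iff] at this
        subst this; rfl
      · have := eq_of_incident_joins h2 hp
        simp only [vv.injective.eq_iff] at this
        rcases this with rfl | rfl
        · rfl
        · simp [irung]
    · have h2 : (1 : Fin 3) ≠ 2 := by decide
      simp only [edm, cst, if_neg h2]
      rcases hst b with ⟨h1, h2⟩ | ⟨h1, h2⟩
      · have := eq_of_incident_semi h2 hp
        rw [vv.injective.eq_iff] at this
        subst this; simp
      · have := eq_of_incident_joins h2 hp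
        simp only [vv.injective.eq_iff] at this
        rcases this with rfl | rfl <;> simp [ist]
    · have h2 : col (en b) ≠ 2 := by
        intro h2; have := cen b; rw [h2] at this; simp at this; omega
      simp only [edm, cen, if_neg h2]
      have hm' : ¬ (m - 1 + 1 < m) := by omega
      rcases hen b with ⟨h1, h2⟩ | ⟨h1, h2⟩
      · have := eq_of_incident_semi h2 hp
        rw [vv.injective.eq_iff] at this
        subst this; simp [hm']
      · have := eq_of_incident_joins h2 hp
        simp only [vv.injective.eq_iff] at this
        rcases this with rfl | rfl <;> simp [ien, hm']
  have hcol : ∀ p i, col (edm p i) = i := by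
    rintro ⟨⟨k, hk⟩, b⟩ i
    simp only [edm]
    split_ifs with h1 h2 h3 h3
    · rw [crung, h1]
    · apply Fin.ext; rw [crail]; exact h2
    · apply Fin.ext; rw [cen, ← h2]; simp at h3; congr 1; omega
    · apply Fin.ext; rw [crail]; omega
    · rw [cst]; simp at h2 h3; apply Fin.ext; simp; omega
  have hends : ∀ p i, (mdl m ρ s t i p = p ∧ P.ends (edm p i) = .semi (vv p)) ∨
      (mdl m ρ s t i p ≠ p ∧ P.joins (edm p i) (vv p) (vv (mdl m ρ s t i p))) := by
    rintro ⟨⟨k, hk⟩, b⟩ i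
    simp only [edm, mdl]
    split_ifs with h1 h2 h3 h3
    · simpa using hrung ⟨k, hk⟩ b
    · right; exact ⟨by simp, Or.inl (hrail k h3 b)⟩
    · have : k = m - 1 := by simp at h3; omega
      subst this
      simpa using hen b
    · right
      refine ⟨by simp; omega, Or.inr ?_⟩
      have h4 : k - 1 + 1 = k := by omega
      have := hrail (k - 1) (by omega) b
      simp only [h4] at this
      exact this
    · have : k = 0 := by simp at h3; omega
      subst this
      simpa using hst b
  refine ⟨{ col := col
            ed := fun v i => edm (vv.symm v) i
            τ := fun i v => vv (mdl m ρ s t i (vv.symm v))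
            col_ed := fun v i => hcol _ _
            uniq := ?_
            ends_ed := ?_ }, by intro i v; simp⟩
  · intro e v h
    obtain ⟨p, rfl⟩ := vv.surjective v
    simpa using hu e p h
  · intro v i
    obtain ⟨p, rfl⟩ := vv.surjective v
    simpa [vv.injective.eq_iff] using hends p i

/-- Swapping the two sides of the ladder. -/
def flp (b : Fin 2) : Fin 2 := 1 - b

theorem flp_ne (b : Fin 2) : flp b ≠ b := by revert b; decide

theorem flp_flp (b : Fin 2) : flp (flp b) = b := by revert b; decide

/-- The colour of the edge from level `k` to level `k+1`. -/
def par3 (k : ℕ) : Fin 3 := ⟨k % 2, by omega⟩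

theorem tri_dc (m : ℕ) [NeZero m] : ∃ T : TriCol (dcLadder m),
    ∀ i (p : Fin m × Fin 2), T.τ i p = mdl m flp flp flp i p := by
  have hm : 0 < m := Nat.pos_of_ne_zero (NeZero.ne m)
  have hj : ∀ (e : (dcLadder m).E) (k : Fin m) (b : Fin 2),
      (dcLadder m).ends e = .edge (k, 0) (k, 1) →
      (dcLadder m).joins e (k, b) (k, flp b) := by
    intro e k b h
    fin_cases b
    · exact Or.inl h
    · exact Or.inr h
  refine mkTri (dcLadder m) m hm flp flp flp (Equiv.refl _)
    (fun k h b => .inl (⟨k, by omega⟩, b)) (fun k _ => .inr (.inl k))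
    (fun _ => .inr (.inr 0)) (fun _ => .inr (.inr 1))
    (fun e => match e with
      | .inl (k, _) => par3 k.1
      | .inr (.inl _) => 2
      | .inr (.inr j) => if j = 0 then 1 else par3 (m - 1))
    ?_ ?_ ?_ ?_ ?_ ?_ ?_ ?_ ?_ ?_ ?_ ?_
  · intro k h b; rfl
  · intro k b; exact Or.inr ⟨flp_ne b, hj _ _ _ rfl⟩
  · intro b; exact Or.inr ⟨flp_ne b, hj _ _ _ rfl⟩
  · intro b; exact Or.inr ⟨flp_ne b, hj _ _ _ rfl⟩
  · rintro (⟨⟨k, hk⟩, b⟩ | k | j)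
    · exact Or.inl ⟨k, by omega, b, rfl⟩
    · exact Or.inr (Or.inl ⟨k, 0, rfl⟩)
    · fin_cases j
      · exact Or.inr (Or.inr (Or.inl ⟨0, rfl⟩))
      · exact Or.inr (Or.inr (Or.inr ⟨0, rfl⟩))
  · intro k h b; rfl
  · intro k b; rfl
  · intro b; rfl
  · intro b; rfl
  · intro k b; rfl
  · intro b; rfl
  · intro b; rfl

theorem tri_do (m : ℕ) [NeZero m] : ∃ T : TriCol (doLadder m),
    ∀ i (p : Fin m × Fin 2), T.τ i p = mdl m flp id id i p := by
  have hm : 0 < m := Nat.pos_of_ne_zero (NeZero.ne m)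
  have hj : ∀ (e : (doLadder m).E) (k : Fin m) (b : Fin 2),
      (doLadder m).ends e = .edge (k, 0) (k, 1) →
      (doLadder m).joins e (k, b) (k, flp b) := by
    intro e k b h
    fin_cases b
    · exact Or.inl h
    · exact Or.inr h
  refine mkTri (doLadder m) m hm flp id id (Equiv.refl _)
    (fun k h b => .inl (⟨k, by omega⟩, b)) (fun k _ => .inr (.inl k))
    (fun b => .inr (.inr (0, b))) (fun b => .inr (.inr (1, b)))
    (fun e => match e with
      | .inl (k, _) => par3 k.1
      | .inr (.inl _) => 2
      | .inr (.inr (j, _)) => if j = 0 then 1 else par3 (m - 1))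
    ?_ ?_ ?_ ?_ ?_ ?_ ?_ ?_ ?_ ?_ ?_ ?_
  · intro k h b; rfl
  · intro k b; exact Or.inr ⟨flp_ne b, hj _ _ _ rfl⟩
  · intro b; exact Or.inl ⟨rfl, rfl⟩
  · intro b; exact Or.inl ⟨rfl, rfl⟩
  · rintro (⟨⟨k, hk⟩, b⟩ | k | ⟨j, b⟩)
    · exact Or.inl ⟨k, by omega, b, rfl⟩
    · exact Or.inr (Or.inl ⟨k, 0, rfl⟩)
    · fin_cases j
      · exact Or.inr (Or.inr (Or.inl ⟨b, rfl⟩))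
      · exact Or.inr (Or.inr (Or.inr ⟨b, rfl⟩))
  · intro k h b; rfl
  · intro k b; rfl
  · intro b; rfl
  · intro b; rfl
  · intro k b; rfl
  · intro b; rfl
  · intro b; rfl

theorem tri_oc (m : ℕ) [NeZero m] : ∃ T : TriCol (ocLadder m),
    ∀ i (p : Fin m × Fin 2), T.τ i p = mdl m flp flp id i p := by
  have hm : 0 < m := Nat.pos_of_ne_zero (NeZero.ne m)
  have hj : ∀ (e : (ocLadder m).E) (k : Fin m) (b : Fin 2),
      (ocLadder m).ends e = .edge (k, 0) (k, 1) →
      (ocLadder m).joins e (k, b) (k, flp b) := by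
    intro e k b h
    fin_cases b
    · exact Or.inl h
    · exact Or.inr h
  refine mkTri (ocLadder m) m hm flp flp id (Equiv.refl _)
    (fun k h b => .inl (⟨k, by omega⟩, b)) (fun k _ => .inr (.inl k))
    (fun b => .inr (.inr (.inl ()))) (fun b => .inr (.inr (.inr b)))
    (fun e => match e with
      | .inl (k, _) => par3 k.1
      | .inr (.inl _) => 2
      | .inr (.inr (.inl _)) => 1
      | .inr (.inr (.inr _)) => par3 (m - 1))
    ?_ ?_ ?_ ?_ ?_ ?_ ?_ ?_ ?_ ?_ ?_ ?_
  · intro k h b; rfl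
  · intro k b; exact Or.inr ⟨flp_ne b, hj _ _ _ rfl⟩
  · intro b; exact Or.inr ⟨flp_ne b, hj _ _ _ rfl⟩
  · intro b; exact Or.inl ⟨rfl, rfl⟩
  · rintro (⟨⟨k, hk⟩, b⟩ | k | _ | b)
    · exact Or.inl ⟨k, by omega, b, rfl⟩
    · exact Or.inr (Or.inl ⟨k, 0, rfl⟩)
    · exact Or.inr (Or.inr (Or.inl ⟨0, rfl⟩))
    · exact Or.inr (Or.inr (Or.inr ⟨b, rfl⟩))
  · intro k h b; rfl
  · intro k b; rfl
  · intro b; rfl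
  · intro b; rfl
  · intro k b; rfl
  · intro b; rfl
  · intro b; rfl

theorem tri_bp (m : ℕ) [NeZero m] : ∃ T : TriCol (barbedPath m),
    ∀ i (p : Fin m × Unit), T.τ i p.1 = (mdl m id id id i p).1 := by
  have hm : 0 < m := Nat.pos_of_ne_zero (NeZero.ne m)
  refine mkTri (barbedPath m) m hm id id id (Equiv.prodPUnit (Fin m))
    (fun k h b => .inl ⟨k, by omega⟩) (fun k _ => .inr (.inl k))
    (fun b => .inr (.inr 0)) (fun b => .inr (.inr 1))
    (fun e => match e with
      | .inl k => par3 k.1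
      | .inr (.inl _) => 2
      | .inr (.inr j) => if j = 0 then 1 else par3 (m - 1))
    ?_ ?_ ?_ ?_ ?_ ?_ ?_ ?_ ?_ ?_ ?_ ?_
  · intro k h b; rfl
  · intro k b; exact Or.inl ⟨rfl, rfl⟩
  · intro b; exact Or.inl ⟨rfl, rfl⟩
  · intro b; exact Or.inl ⟨rfl, rfl⟩
  · rintro (⟨k, hk⟩ | k | j)
    · exact Or.inl ⟨k, by omega, (), rfl⟩
    · exact Or.inr (Or.inl ⟨k, (), rfl⟩)
    · fin_cases j
      · exact Or.inr (Or.inr (Or.inl ⟨(), rfl⟩))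
      · exact Or.inr (Or.inr (Or.inr ⟨(), rfl⟩))
  · intro k h b; rfl
  · intro k b; rfl
  · intro b; rfl
  · intro b; rfl
  · intro k b; rfl
  · intro b; rfl
  · intro b; rfl

/-- The model involutions commute when the twists commute with the rung involution. -/
theorem mdl_comm (m : ℕ) {B : Type} (ρ s t : B → B) (hs : ∀ b, s (ρ b) = ρ (s b))
    (ht : ∀ b, t (ρ b) = ρ (t b)) (i : Fin 3) (p : Fin m × B) :
    mdl m ρ s t i (mdl m ρ s t 2 p) = mdl m ρ s t 2 (mdl m ρ s t i p) := by
  simp only [mdl]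
  split_ifs <;> simp_all

/-- Reversal of the model. -/
theorem mdl_rev (m : ℕ) (hm : m % 2 = 1) {B : Type} (ρ s : B → B) (i : Fin 3) (p : Fin m × B) :
    ((mdl m ρ s s i p).1.rev, (mdl m ρ s s i p).2) =
      mdl m ρ s s (swp i) (p.1.rev, p.2) := by
  obtain ⟨⟨k, hk⟩, b⟩ := p
  have h3 : i = 0 ∨ i = 1 ∨ i = 2 := by revert i; decide
  rcases h3 with rfl | rfl | rfl <;> simp only [mdl, swp, Fin.val_rev] <;> simp
  all_goals
    split_ifs <;> first | omega | (ext <;> simp [Fin.val_rev] <;> omega)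

theorem mult_dc (m : ℕ) [NeZero m] (hm : m % 2 = 0) {P : Pregraph} (φ : Iso P (dcLadder m)) :
    HasMultipleCQFactors P := by
  obtain ⟨T, hT⟩ := tri_dc m
  have hT' : T.τ = (mdl m flp flp flp : Fin 3 → Fin m × Fin 2 → Fin m × Fin 2) := by
    funext i p; exact hT i p
  have hm0 : 0 < m := Nat.pos_of_ne_zero (NeZero.ne m)
  refine multiple_of_iso φ T (fun v => ?_) (fun v => ?_) (Or.inl ⟨?_, fun v => ?_⟩)
  · rw [hT']; refine mdl_comm _ _ _ _ ?_ ?_ _ _ <;> exact fun _ => rfl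
  · rw [hT']; refine mdl_comm _ _ _ _ ?_ ?_ _ _ <;> exact fun _ => rfl
  · refine ⟨((⟨0, hm0⟩, 0) : Fin m × Fin 2), ?_⟩
    rw [hT, hT]; simp [mdl]; rfl
  · obtain ⟨⟨k, hk⟩, b⟩ := v
    rw [hT, hT]
    simp only [mdl]
    simp
    intro h
    have := congrArg (fun q : Fin m × Fin 2 => q.1.val) h
    split_ifs at this <;> simp at this <;> omega

theorem mult_do (m : ℕ) [NeZero m] (hm : m % 2 = 0) {P : Pregraph} (φ : Iso P (doLadder m)) :
    HasMultipleCQFactors P := by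
  obtain ⟨T, hT⟩ := tri_do m
  have hT' : T.τ = (mdl m flp id id : Fin 3 → Fin m × Fin 2 → Fin m × Fin 2) := by
    funext i p; exact hT i p
  have hm0 : 0 < m := Nat.pos_of_ne_zero (NeZero.ne m)
  refine multiple_of_iso φ T (fun v => ?_) (fun v => ?_) (Or.inr ⟨?_, fun v => ?_, fun v => ?_⟩)
  · rw [hT']; refine mdl_comm _ _ _ _ ?_ ?_ _ _ <;> exact fun _ => rfl
  · rw [hT']; refine mdl_comm _ _ _ _ ?_ ?_ _ _ <;> exact fun _ => rfl
  · refine ⟨((⟨0, hm0⟩, 0) : Fin m × Fin 2), ?_⟩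
    rw [hT]; simp [mdl]; rfl
  · obtain ⟨⟨k, hk⟩, b⟩ := v
    rw [hT]
    simp only [mdl]
    simp
    intro h
    have := congrArg (fun q : Fin m × Fin 2 => q.1.val) h
    split_ifs at this <;> simp at this <;> omega
  · obtain ⟨⟨k, hk⟩, b⟩ := v
    rw [hT]
    simp only [mdl]
    intro h
    exact flp_ne b (congrArg Prod.snd h)

theorem mult_oc (m : ℕ) [NeZero m] {P : Pregraph} (φ : Iso P (ocLadder m)) :
    HasMultipleCQFactors P := by
  obtain ⟨T, hT⟩ := tri_oc m
  have hT' : T.τ = (mdl m flp flp id : Fin 3 → Fin m × Fin 2 → Fin m × Fin 2) := by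
    funext i p; exact hT i p
  have hm0 : 0 < m := Nat.pos_of_ne_zero (NeZero.ne m)
  refine multiple_of_iso φ T (fun v => ?_) (fun v => ?_) (Or.inl ⟨?_, fun v => ?_⟩)
  · rw [hT']; refine mdl_comm _ _ _ _ ?_ ?_ _ _ <;> exact fun _ => rfl
  · rw [hT']; refine mdl_comm _ _ _ _ ?_ ?_ _ _ <;> exact fun _ => rfl
  · refine ⟨((⟨0, hm0⟩, 0) : Fin m × Fin 2), ?_⟩
    rw [hT, hT]; simp [mdl]; rfl
  · obtain ⟨⟨k, hk⟩, b⟩ := v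
    rw [hT, hT]
    simp only [mdl]
    simp
    intro h
    have h1 := congrArg (fun q : Fin m × Fin 2 => q.1.val) h
    have h2 := congrArg (fun q : Fin m × Fin 2 => q.2) h
    have h3 := flp_ne b
    split_ifs at h1 h2 <;> simp at h1 h2 <;> first | omega | exact h3 h2.symm

theorem mult_bp (m : ℕ) [NeZero m] (hm : m % 2 = 0) {P : Pregraph} (φ : Iso P (barbedPath m)) :
    HasMultipleCQFactors P := by
  obtain ⟨T, hT⟩ := tri_bp m
  have hT' : ∀ i (k : Fin m), T.τ i k = (mdl m (B := Unit) id id id i (k, ())).1 :=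
    fun i k => hT i (k, ())
  have hm0 : 0 < m := Nat.pos_of_ne_zero (NeZero.ne m)
  refine multiple_of_iso φ T (fun v => ?_) (fun v => ?_) (Or.inl ⟨?_, fun v => ?_⟩)
  · exact (hT' _ _).trans ((congrArg (fun k => (mdl m (B := Unit) id id id 0 (k, ())).1) (hT' 2 v)).trans
      ((congrArg Prod.fst (mdl_comm m (B := Unit) id id id (fun _ => rfl) (fun _ => rfl) 0 (v, ()))).trans
      ((hT' _ _).trans (congrArg (fun k => (mdl m (B := Unit) id id id 2 (k, ())).1) (hT' 0 v))).symm))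
  · exact (hT' _ _).trans ((congrArg (fun k => (mdl m (B := Unit) id id id 1 (k, ())).1) (hT' 2 v)).trans
      ((congrArg Prod.fst (mdl_comm m (B := Unit) id id id (fun _ => rfl) (fun _ => rfl) 1 (v, ()))).trans
      ((hT' _ _).trans (congrArg (fun k => (mdl m (B := Unit) id id id 2 (k, ())).1) (hT' 1 v))).symm))
  · refine ⟨(⟨0, hm0⟩ : Fin m), ?_⟩
    rw [hT', hT']; simp [mdl]; rfl
  · obtain ⟨k, hk⟩ := v
    rw [hT', hT']
    simp only [mdl]
    simp
    intro h
    have := congrArg (fun q : Fin m => q.val) h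
    split_ifs at this <;> simp at this <;> omega

end TriCol
end Pregraph

namespace Pregraph
namespace TriCol

variable {P : Pregraph} (T : TriCol P)

/-- The alternating walk. -/
def walk (v₀ : P.V) : ℕ → P.V
  | 0 => v₀
  | k + 1 => T.τ (par3 k) (walk v₀ k)

/-- Lying on the same rung. -/
def rel (u v : P.V) : Prop := v = u ∨ v = T.τ 2 u

/-- The rung involution commutes with the others. -/
def Comm : Prop := ∀ i v, T.τ i (T.τ 2 v) = T.τ 2 (T.τ i v)

theorem rel_symm {u v : P.V} (h : T.rel u v) : T.rel v u := by
  rcases h with rfl | rfl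
  · exact Or.inl rfl
  · exact Or.inr (by simp)

theorem rel_trans {u v w : P.V} (h : T.rel u v) (h' : T.rel v w) : T.rel u w := by
  unfold rel at *
  rcases h with rfl | rfl <;> rcases h' with rfl | rfl <;> simp

theorem rel_τ (hc : T.Comm) (i : Fin 3) {u v : P.V} (h : T.rel u v) :
    T.rel (T.τ i u) (T.τ i v) := by
  rcases h with rfl | rfl
  · exact Or.inl rfl
  · exact Or.inr (hc i u)

theorem par3_add_two (k : ℕ) : par3 (k + 2) = par3 k := by
  apply Fin.ext; simp [par3]

theorem par3_add_two_mul (k d : ℕ) : par3 (k + 2 * d) = par3 k := by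
  apply Fin.ext; simp [par3]

theorem par3_ne (k : ℕ) : par3 k ≠ 2 := by
  intro h
  have := congrArg Fin.val h
  simp [par3] at this; omega

theorem walk_succ (v₀ : P.V) (k : ℕ) : T.walk v₀ (k + 1) = T.τ (par3 k) (T.walk v₀ k) := rfl

theorem walk_back (v₀ : P.V) (k : ℕ) : T.τ (par3 k) (T.walk v₀ (k + 1)) = T.walk v₀ k := by
  rw [walk_succ, τ_τ]

theorem foldA (hc : T.Comm) (v₀ : P.V) (d : ℕ) : ∀ i,
    T.rel (T.walk v₀ i) (T.walk v₀ (i + 2 * d + 1)) →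
    ∃ t, t < i + 2 * d + 1 ∧ T.rel (T.walk v₀ t) (T.walk v₀ (t + 1)) := by
  induction d with
  | zero => intro i h; exact ⟨i, by omega, h⟩
  | succ d ih =>
    intro i h
    have h1 := T.rel_τ hc (par3 i) h
    rw [← walk_succ, ← par3_add_two_mul i (d + 1), walk_back] at h1
    have h2 : i + 2 * (d + 1) = i + 1 + 2 * d + 1 := by ring
    rw [h2] at h1
    obtain ⟨t, ht, h3⟩ := ih (i + 1) h1
    exact ⟨t, by omega, h3⟩

theorem foldB (hc : T.Comm) (v₀ : P.V) (h0 : T.rel (T.τ 1 v₀) v₀) : ∀ i j, i < j →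
    T.rel (T.walk v₀ i) (T.walk v₀ j) →
    ∃ t, t < j ∧ T.rel (T.walk v₀ t) (T.walk v₀ (t + 1)) := by
  intro i
  induction i with
  | zero =>
    intro j hj h
    rcases Nat.even_or_odd' j with ⟨d, rfl | rfl⟩
    · obtain ⟨d, rfl⟩ : ∃ c, d = c + 1 := ⟨d - 1, by omega⟩
      have h1 := T.rel_τ hc 1 h
      have h2 : T.τ 1 (T.walk v₀ (2 * (d + 1))) = T.walk v₀ (0 + 2 * d + 1) := by
        have h3 : (1 : Fin 3) = par3 (2 * d + 1) := by apply Fin.ext; simp [par3]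
        rw [h3, show 2 * (d + 1) = (2 * d + 1) + 1 by ring, walk_back]; simp
      rw [h2] at h1
      obtain ⟨t, ht, h3⟩ := T.foldA hc v₀ d 0 (T.rel_trans (T.rel_symm h0) h1)
      exact ⟨t, by omega, h3⟩
    · obtain ⟨t, ht, h3⟩ := T.foldA hc v₀ d 0 (by simpa using h)
      exact ⟨t, by omega, h3⟩
  | succ i ih =>
    intro j hj h
    obtain ⟨j, rfl⟩ : ∃ c, j = c + 1 := ⟨j - 1, by omega⟩
    rcases Nat.even_or_odd' (j - i) with ⟨d, hd | hd⟩
    · have h1 := T.rel_τ hc (par3 i) h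
      rw [walk_back] at h1
      have : j = i + 2 * d := by omega
      rw [this, ← par3_add_two_mul i d, walk_back, ← this] at h1
      obtain ⟨t, ht, h3⟩ := ih j (by omega) h1
      exact ⟨t, by omega, h3⟩
    · have : j + 1 = i + 1 + 2 * d + 1 := by omega
      rw [this] at h ⊢
      exact T.foldA hc v₀ d (i + 1) h

theorem adj_iff {u v : P.V} (h : P.Adj u v) : ∃ i, v = T.τ i u := by
  obtain ⟨e, he⟩ := h
  refine ⟨T.col e, ?_⟩
  have h1 := T.uniq _ _ (incident_of_joins he)
  rcases T.ends_ed u (T.col e) with ⟨_, h3⟩ | ⟨_, h3⟩ <;> rw [← h1] at h3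
  · rcases he with he | he <;> rw [h3] at he <;> simp at he
  · exact joins_right_unique he h3

theorem closed_univ (hcon : P.Connected) (p : P.V → Prop) (hp : ∀ i v, p v → p (T.τ i v))
    (h0 : ∃ v, p v) (v : P.V) : p v := by
  obtain ⟨u, hu⟩ := h0
  have := hcon u v
  induction this with
  | refl => exact hu
  | tail _ h ih =>
    obtain ⟨i, rfl⟩ := T.adj_iff h
    exact hp i _ ih

/-- There is a colour swapping symmetry. -/
def HasSwap : Prop := ∃ σ : P.V ≃ P.V, ∀ i v, σ (T.τ i v) = T.τ (swp i) (σ v)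

theorem hasSwap_swap (h : T.swap.HasSwap) : T.HasSwap := by
  obtain ⟨σ, hσ⟩ := h
  refine ⟨σ, fun i v => ?_⟩
  have := hσ (swp i) v
  simpa [swap] using this

theorem equivariant (v₀ : P.V) (m : ℕ) (hm : 0 < m) {B : Type} (ρ s t : B → B)
    (r : B → P.V → P.V)
    (hr : ∀ i b v, i ≠ 2 → T.τ i (r b v) = r b (T.τ i v))
    (hr2 : ∀ b v, T.τ 2 (r b v) = r (ρ b) v)
    (hs : ∀ b, T.τ 1 (r b v₀) = r (s b) v₀)
    (ht : ∀ b, T.τ (par3 (m - 1)) (r b (T.walk v₀ (m - 1))) = r (t b) (T.walk v₀ (m - 1)))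
    (i : Fin 3) (p : Fin m × B) :
    r (mdl m ρ s t i p).2 (T.walk v₀ (mdl m ρ s t i p).1) = T.τ i (r p.2 (T.walk v₀ p.1)) := by
  obtain ⟨⟨k, hk⟩, b⟩ := p
  by_cases hi : i = 2
  · subst hi; simp [mdl, hr2]
  · have hi' : i = 0 ∨ i = 1 := by revert i; decide
    simp only [mdl, if_neg hi]
    split_ifs with h1 h2 h2
    · have : i = par3 k := by apply Fin.ext; simp [par3]; omega
      rw [hr _ _ _ hi, this]; rfl
    · have : i = par3 k := by apply Fin.ext; simp [par3]; omega
      have h3 : k = m - 1 := by omega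
      subst h3
      rw [this]; exact (ht b).symm
    · obtain ⟨k, rfl⟩ : ∃ c, k = c + 1 := ⟨k - 1, by omega⟩
      have : i = par3 k := by
        apply Fin.ext; simp only [par3]
        rcases hi' with rfl | rfl <;> simp at * <;> omega
      rw [hr _ _ _ hi, this, walk_back]; rfl
    · have h3 : k = 0 := by omega
      subst h3
      have : i = 1 := by
        rcases hi' with rfl | rfl <;> simp at *
      subst this
      exact (hs b).symm

theorem mkEquiv (hcon : P.Connected) (m : ℕ) {B : Type} (ρ s t : B → B)
    (W : Fin m × B → P.V) (hne : Nonempty (Fin m × B))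
    (heq : ∀ i p, W (mdl m ρ s t i p) = T.τ i (W p)) (hinj : Function.Injective W) :
    ∃ W' : Fin m × B ≃ P.V, ∀ i p, W' (mdl m ρ s t i p) = T.τ i (W' p) := by
  refine ⟨Equiv.ofBijective W ⟨hinj, ?_⟩, heq⟩
  apply T.closed_univ hcon (fun v => ∃ p, W p = v)
  · rintro i _ ⟨p, rfl⟩; exact ⟨_, heq i p⟩
  · obtain ⟨p⟩ := hne; exact ⟨_, p, rfl⟩

theorem hasSwap_of_mdl (m : ℕ) (hm : m % 2 = 1) {B : Type} (ρ s : B → B)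
    (W : Fin m × B ≃ P.V) (h : ∀ i p, W (mdl m ρ s s i p) = T.τ i (W p)) : T.HasSwap := by
  let rv : Fin m × B ≃ Fin m × B := Equiv.prodCongr Fin.revPerm (Equiv.refl B)
  refine ⟨W.symm.trans (rv.trans W), fun i v => ?_⟩
  obtain ⟨p, rfl⟩ := W.surjective v
  rw [← h]
  simp only [Equiv.trans_apply, Equiv.symm_apply_apply]
  rw [← h]
  exact congrArg W (mdl_rev m hm ρ s i p)

/-- The conclusion of the classification. -/
def Concl (P : Pregraph) : Prop :=
  ∃ (m : ℕ) (_ : NeZero m),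
    (Fintype.card P.V = m ∧ m % 2 = 0 ∧ Nonempty (Iso P (barbedPath m))) ∨
    (Fintype.card P.V = 2 * m ∧ (Nonempty (Iso P (ocLadder m)) ∨
      (m % 2 = 0 ∧ (Nonempty (Iso P (doLadder m)) ∨ Nonempty (Iso P (dcLadder m))))))

theorem iso_of_mdl {Q : Pregraph} (S : TriCol Q) (W : Q.V ≃ P.V)
    (h : ∀ i v, W (S.τ i v) = T.τ i (W v)) : Nonempty (Iso P Q) := by
  obtain ⟨φ, _⟩ := exists_iso T S W.symm (fun i v => by
    rw [Equiv.symm_apply_eq, h]; simp)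
  exact ⟨φ⟩

theorem cls_start (hcon : P.Connected) (hc : T.Comm) (hns : ¬ T.HasSwap) (v₀ : P.V)
    (h0 : T.τ 1 v₀ = v₀ ∨ T.τ 1 v₀ = T.τ 2 v₀)
    (hpref : T.τ 1 v₀ = v₀ → ∀ v j, j ≠ 2 → T.τ j v = T.τ 2 v → T.τ 2 v = v) : Concl P := by
  classical
  have hrel0 : T.rel (T.τ 1 v₀) v₀ := by
    rcases h0 with h0 | h0
    · rw [h0]; exact Or.inl rfl
    · rw [h0]; exact Or.inr (by simp)
  have hex : ∃ t, T.rel (T.walk v₀ t) (T.walk v₀ (t + 1)) := by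
    obtain ⟨i, j, hij, h⟩ := Finite.exists_ne_map_eq_of_infinite (T.walk v₀)
    rcases lt_or_gt_of_ne hij with hl | hl
    · obtain ⟨t, _, ht⟩ := T.foldB hc v₀ hrel0 i j hl (Or.inl h.symm)
      exact ⟨t, ht⟩
    · obtain ⟨t, _, ht⟩ := T.foldB hc v₀ hrel0 j i hl (Or.inl h)
      exact ⟨t, ht⟩
  obtain ⟨m, hm, hend, hmin⟩ : ∃ m, 0 < m ∧ T.rel (T.walk v₀ (m - 1)) (T.walk v₀ (m - 1 + 1)) ∧
      ∀ t, t < m - 1 → ¬ T.rel (T.walk v₀ t) (T.walk v₀ (t + 1)) :=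
    ⟨Nat.find hex + 1, by omega, by simpa using Nat.find_spec hex,
      fun t ht => Nat.find_min hex (by simpa using ht)⟩
  have hdist : ∀ i j, i < m → j < m → T.rel (T.walk v₀ i) (T.walk v₀ j) → i = j := by
    intro i j hi hj h
    by_contra hne
    rcases lt_or_gt_of_ne hne with hl | hl
    · obtain ⟨t, h1, h2⟩ := T.foldB hc v₀ hrel0 i j hl h
      exact hmin t (by omega) h2
    · obtain ⟨t, h1, h2⟩ := T.foldB hc v₀ hrel0 j i hl (T.rel_symm h)
      exact hmin t (by omega) h2
  rw [walk_succ] at hend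
  have : NeZero m := ⟨by omega⟩
  refine ⟨m, this, ?_⟩
  by_cases hR : ∃ v, T.τ 2 v = v
  · left
    have hR' : ∀ v, T.τ 2 v = v :=
      T.closed_univ hcon (fun v => T.τ 2 v = v) (fun i v h => by rw [← hc, h]) hR
    simp only [rel, hR', or_self] at hend h0
    obtain ⟨W, hW⟩ := T.mkEquiv hcon m (B := Unit) id id id
      (fun p => T.walk v₀ p.1) ⟨⟨⟨0, hm⟩, ()⟩⟩
      (T.equivariant v₀ m hm id id id (fun _ v => v) (fun _ _ _ _ => rfl)
        (fun _ v => hR' v) (fun _ => h0) (fun _ => hend))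
      (by
        rintro ⟨⟨i, hi⟩, b⟩ ⟨⟨j, hj⟩, b'⟩ h
        have := hdist i j hi hj (Or.inl h.symm)
        subst this; rfl)
    have hcard : Fintype.card P.V = m := by
      rw [← Fintype.card_congr W]; simp
    refine ⟨hcard, ?_, ?_⟩
    · by_contra hodd
      exact hns (T.hasSwap_of_mdl m (by omega) id id W hW)
    · obtain ⟨S, hS⟩ := tri_bp m
      refine T.iso_of_mdl S ((Equiv.prodPUnit (Fin m)).symm.trans W) (fun i v => ?_)
      have h1 := hS i (v, ())
      have h2 := hW i (v, ())
      have h3 : ((S.τ i v, ()) : Fin m × Unit) = mdl m id id id i (v, ()) := Prod.ext h1 rfl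
      exact (congrArg W h3).trans h2
  · right
    have hR' : ∀ v, T.τ 2 v ≠ v := fun v h => hR ⟨v, h⟩
    let r : Fin 2 → P.V → P.V := fun b v => if b = 0 then v else T.τ 2 v
    have r0 : ∀ v, r 0 v = v := fun v => rfl
    have r1 : ∀ v, r 1 v = T.τ 2 v := fun v => rfl
    have f0 : flp 0 = 1 := rfl
    have f1 : flp 1 = 0 := rfl
    have two : ∀ p : Fin 2 → Prop, p 0 → p 1 → ∀ b, p b := by
      intro p h0 h1 b; fin_cases b <;> assumption
    have hr : ∀ i b v, i ≠ 2 → T.τ i (r b v) = r b (T.τ i v) := by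
      intro i b v _; revert b
      apply two
      · rfl
      · rw [r1, r1, hc]
    have hr2 : ∀ b v, T.τ 2 (r b v) = r (flp b) v := by
      intro b v; revert b
      apply two
      · rfl
      · rw [r1, f1, r0, τ_τ]
    have hopen : ∀ i v, T.τ i v = v → ∀ b, T.τ i (r b v) = r (id b) v := by
      intro i v h
      apply two
      · exact h
      · simp only [r1, id]; rw [hc, h]
    have hclosed : ∀ i v, T.τ i v = T.τ 2 v → ∀ b, T.τ i (r b v) = r (flp b) v := by
      intro i v h
      apply two
      · exact h
      · rw [r1, f1, r0, hc, h, τ_τ]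
    have main : ∀ s t : Fin 2 → Fin 2, (∀ b, T.τ 1 (r b v₀) = r (s b) v₀) →
        (∀ b, T.τ (par3 (m - 1)) (r b (T.walk v₀ (m - 1))) = r (t b) (T.walk v₀ (m - 1))) →
        ∃ W' : Fin m × Fin 2 ≃ P.V, ∀ i p, W' (mdl m flp s t i p) = T.τ i (W' p) := by
      intro s t hs ht
      refine T.mkEquiv hcon m flp s t (fun p => r p.2 (T.walk v₀ p.1)) ⟨⟨⟨0, hm⟩, 0⟩⟩
        (T.equivariant v₀ m hm flp s t r hr hr2 hs ht) ?_
      rintro ⟨⟨i, hi⟩, b⟩ ⟨⟨j, hj⟩, b'⟩ h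
      have hrr : ∀ b v, T.rel v (r b v) := by
        intro b v; revert b
        apply two
        · exact Or.inl rfl
        · exact Or.inr rfl
      simp only at h
      have h1 := hrr b (T.walk v₀ i)
      rw [h] at h1
      have := hdist i j hi hj (T.rel_trans h1 (T.rel_symm (hrr b' _)))
      subst this
      have hb : b = b' := by
        have h2 := hR' (T.walk v₀ i)
        have key : ∀ b b', r b (T.walk v₀ i) = r b' (T.walk v₀ i) → b = b' := by
          apply two (p := fun b => ∀ b', r b (T.walk v₀ i) = r b' (T.walk v₀ i) → b = b')
          · apply two
            · intro _; rfl
            · intro h; exact absurd h.symm h2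
          · apply two
            · intro h; exact absurd h h2
            · intro _; rfl
        exact key b b' h
      subst hb; rfl
    have hcard : ∀ W : Fin m × Fin 2 ≃ P.V, Fintype.card P.V = 2 * m := by
      intro W
      rw [← Fintype.card_congr W]; simp; ring
    have hend' := T.rel_symm hend
    have hend : T.τ (par3 (m - 1)) (T.walk v₀ (m - 1)) = T.walk v₀ (m - 1) ∨
        T.τ (par3 (m - 1)) (T.walk v₀ (m - 1)) = T.τ 2 (T.walk v₀ (m - 1)) := hend
    by_cases h1 : T.τ 1 v₀ = v₀
    · have h2 := hpref h1
      have h3 : T.τ (par3 (m - 1)) (T.walk v₀ (m - 1)) = T.walk v₀ (m - 1) := by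
        rcases hend with h | h
        · exact h
        · exact absurd (h2 _ _ (par3_ne _) h) (hR' _)
      obtain ⟨W, hW⟩ := main id id (hopen _ _ h1) (hopen _ _ h3)
      refine ⟨hcard W, Or.inr ⟨?_, Or.inl ?_⟩⟩
      · by_contra hodd
        exact hns (T.hasSwap_of_mdl m (by omega) flp id W hW)
      · obtain ⟨S, hS⟩ := tri_do m
        exact T.iso_of_mdl S W (fun i v => (congrArg W (hS i v)).trans (hW i v))
    · have h1 : T.τ 1 v₀ = T.τ 2 v₀ := by tauto
      rcases hend with h3 | h3
      · obtain ⟨W, hW⟩ := main flp id (hclosed _ _ h1) (hopen _ _ h3)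
        refine ⟨hcard W, Or.inl ?_⟩
        obtain ⟨S, hS⟩ := tri_oc m
        exact T.iso_of_mdl S W (fun i v => (congrArg W (hS i v)).trans (hW i v))
      · obtain ⟨W, hW⟩ := main flp flp (hclosed _ _ h1) (hclosed _ _ h3)
        refine ⟨hcard W, Or.inr ⟨?_, Or.inr ?_⟩⟩
        · by_contra hodd
          exact hns (T.hasSwap_of_mdl m (by omega) flp flp W hW)
        · obtain ⟨S, hS⟩ := tri_dc m
          exact T.iso_of_mdl S W (fun i v => (congrArg W (hS i v)).trans (hW i v))

theorem nofold (hcon : P.Connected) (hc : T.Comm) (v₀ : P.V)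
    (hnf : ∀ v j, j ≠ 2 → T.τ j v ≠ v ∧ T.τ j v ≠ T.τ 2 v) : T.HasSwap := by
  classical
  have hnf' : ∀ k, ¬ T.rel (T.walk v₀ k) (T.walk v₀ (k + 1)) := by
    intro k h
    rw [walk_succ] at h
    have := hnf (T.walk v₀ k) _ (par3_ne k)
    rcases h with h | h
    · exact this.1 h
    · exact this.2 h
  have hpar' : ∀ i j, i < j → T.rel (T.walk v₀ i) (T.walk v₀ j) → i % 2 = j % 2 := by
    intro i j hij h
    by_contra hne
    obtain ⟨d, hd⟩ : ∃ d, j = i + 2 * d + 1 := ⟨(j - i) / 2, by omega⟩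
    rw [hd] at h
    obtain ⟨t, _, ht⟩ := T.foldA hc v₀ d i h
    exact hnf' t ht
  have hpar : ∀ i j, T.rel (T.walk v₀ i) (T.walk v₀ j) → i % 2 = j % 2 := by
    intro i j h
    rcases lt_trichotomy i j with hl | hl | hl
    · exact hpar' i j hl h
    · rw [hl]
    · exact (hpar' j i hl (T.rel_symm h)).symm
  have hper : ∃ p, 0 < p ∧ p % 2 = 0 ∧ T.walk v₀ p = v₀ := by
    obtain ⟨i, j, hij, h⟩ := Finite.exists_ne_map_eq_of_infinite (T.walk v₀)
    have key : ∀ i j, i < j → T.walk v₀ i = T.walk v₀ j →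
        ∃ p, 0 < p ∧ p % 2 = 0 ∧ T.walk v₀ p = v₀ := by
      intro i
      induction i with
      | zero =>
        intro j hj h
        exact ⟨j, hj, (hpar 0 j (Or.inl h.symm)).symm, h.symm⟩
      | succ i ih =>
        intro j hj h
        obtain ⟨j, rfl⟩ : ∃ c, j = c + 1 := ⟨j - 1, by omega⟩
        have hp := hpar _ _ (Or.inl h.symm)
        have hq : par3 i = par3 j := by apply Fin.ext; simp [par3]; omega
        rw [walk_succ, walk_succ, hq] at h
        exact ih j (by omega) (T.τ_inj _ h)
    rcases lt_or_gt_of_ne hij with hl | hl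
    · exact key i j hl h
    · exact key j i hl h.symm
  obtain ⟨p, hp0, hp2, hp⟩ := hper
  -- closure of the walk under the involutions
  have hstep : ∀ k i, i ≠ 2 → ∃ l, l % 2 ≠ k % 2 ∧ T.τ i (T.walk v₀ k) = T.walk v₀ l := by
    intro k i hi
    by_cases h1 : i = par3 k
    · exact ⟨k + 1, by omega, by rw [h1, walk_succ]⟩
    · have back : ∀ c, i ≠ par3 (c + 1) →
          ∃ l, l % 2 ≠ (c + 1) % 2 ∧ T.τ i (T.walk v₀ (c + 1)) = T.walk v₀ l := by
        intro c hcc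
        have h2 : i = par3 c := by
          have hi' : i = 0 ∨ i = 1 := (by decide : ∀ i : Fin 3, i ≠ 2 → i = 0 ∨ i = 1) i hi
          have : i.val ≠ (par3 (c + 1)).val := fun h => hcc (Fin.ext h)
          apply Fin.ext
          simp only [par3] at *
          rcases hi' with rfl | rfl <;> simp at * <;> omega
        exact ⟨c, by omega, by rw [h2, walk_back]⟩
      rcases Nat.eq_zero_or_pos k with rfl | hk
      · obtain ⟨c, rfl⟩ : ∃ c, p = c + 1 := ⟨p - 1, by omega⟩
        have h3 : par3 (c + 1) = par3 0 := by apply Fin.ext; simp [par3]; omega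
        obtain ⟨l, hl, hl'⟩ := back c (by rw [h3]; exact h1)
        rw [hp] at hl'
        exact ⟨l, by omega, hl'⟩
      · obtain ⟨c, rfl⟩ : ∃ c, k = c + 1 := ⟨k - 1, by omega⟩
        exact back c h1
  have hsurj : ∀ v, ∃ k, T.rel (T.walk v₀ k) v := by
    apply T.closed_univ hcon (fun v => ∃ k, T.rel (T.walk v₀ k) v)
    · rintro i v ⟨k, hk⟩
      by_cases hi : i = 2
      · subst hi
        exact ⟨k, T.rel_trans hk (Or.inr rfl)⟩
      · obtain ⟨l, _, hl⟩ := hstep k i hi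
        refine ⟨l, ?_⟩
        rw [← hl]; exact T.rel_τ hc i hk
    · exact ⟨v₀, 0, Or.inl rfl⟩
  choose ix hix using hsurj
  have hu : ∀ v k, T.rel (T.walk v₀ k) v → ix v % 2 = k % 2 := fun v k hk =>
    hpar _ _ (T.rel_trans (hix v) (T.rel_symm hk))
  have hu2 : ∀ v, ix (T.τ 2 v) % 2 = ix v % 2 := fun v =>
    hu _ _ (T.rel_trans (hix v) (Or.inr rfl))
  have hui : ∀ i v, i ≠ 2 → ix (T.τ i v) % 2 ≠ ix v % 2 := by
    intro i v hi
    obtain ⟨l, h1, hl⟩ := hstep (ix v) i hi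
    rw [hu (T.τ i v) l]
    · exact h1
    · rw [← hl]; exact T.rel_τ hc i (hix v)
  have hσ : Function.Injective (fun v => T.τ (par3 (ix v)) v) := by
    intro u v h
    simp only at h
    have h1 := hui _ u (par3_ne (ix u))
    have h2 := hui _ v (par3_ne (ix v))
    rw [h] at h1
    have h3 : par3 (ix u) = par3 (ix v) := by apply Fin.ext; simp [par3]; omega
    rw [h3] at h
    exact T.τ_inj _ h
  refine ⟨Equiv.ofBijective _ (Finite.injective_iff_bijective.1 hσ), fun i v => ?_⟩
  simp only [Equiv.ofBijective_apply]
  by_cases hi : i = 2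
  · subst hi
    have : par3 (ix (T.τ 2 v)) = par3 (ix v) := by apply Fin.ext; simp only [par3]; exact hu2 v
    rw [this, hc]; rfl
  · have h1 := hui i v hi
    have hi' : i = 0 ∨ i = 1 := (by decide : ∀ i : Fin 3, i ≠ 2 → i = 0 ∨ i = 1) i hi
    by_cases h2 : par3 (ix v) = i
    · have h3 : par3 (ix (T.τ i v)) = swp i := by
        have h5 := congrArg Fin.val h2
        clear h2
        apply Fin.ext
        rcases hi' with rfl | rfl <;> simp [swp, par3] at * <;> omega
      rw [h3, h2]
    · have h3 : par3 (ix (T.τ i v)) = i := by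
        apply Fin.ext
        have h5 : (par3 (ix v)).val ≠ i.val := fun h => h2 (Fin.ext h)
        rcases hi' with rfl | rfl <;> simp [par3] at * <;> omega
      have h4 : par3 (ix v) = swp i := by
        apply Fin.ext
        have h5 : (par3 (ix v)).val ≠ i.val := fun h => h2 (Fin.ext h)
        rcases hi' with rfl | rfl <;> simp [par3, swp] at * <;> omega
      rw [h3, h4, τ_τ, τ_τ]

theorem classify (hcon : P.Connected) (hc : T.Comm) (hns : ¬ T.HasSwap) (hne : Nonempty P.V) :
    Concl P := by
  have hcs : T.swap.Comm := fun i v => by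
    have := hc (swp i) v
    simpa [swap, swp] using this
  have hnss : ¬ T.swap.HasSwap := fun h => hns (T.hasSwap_swap h)
  have s2 : ∀ v, T.swap.τ 2 v = T.τ 2 v := fun v => rfl
  have s1 : ∀ v, T.swap.τ 1 v = T.τ 0 v := fun v => rfl
  have i2 : ∀ i : Fin 3, i ≠ 2 → i = 0 ∨ i = 1 := by decide
  by_cases hcl : ∃ v j, j ≠ 2 ∧ T.τ j v = T.τ 2 v ∧ T.τ 2 v ≠ v
  · obtain ⟨v, j, hj, h1, h2⟩ := hcl
    rcases i2 j hj with rfl | rfl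
    · exact T.swap.cls_start hcon hcs hnss v (Or.inr h1)
        (fun h => absurd (h1.symm.trans h) h2)
    · exact T.cls_start hcon hc hns v (Or.inr h1) (fun h => absurd (h1.symm.trans h) h2)
  · push Not at hcl
    by_cases hop : ∃ v j, j ≠ 2 ∧ (T.τ j v = v ∨ T.τ j v = T.τ 2 v)
    · obtain ⟨v, j, hj, h1⟩ := hop
      rcases i2 j hj with rfl | rfl
      · refine T.swap.cls_start hcon hcs hnss v h1 (fun _ v j hj h => ?_)
        refine hcl v (swp j) ?_ h
        exact (by decide : ∀ j : Fin 3, j ≠ 2 → swp j ≠ 2) j hj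
      · exact T.cls_start hcon hc hns v h1 (fun _ => hcl)
    · push Not at hop
      obtain ⟨v⟩ := hne
      exact absurd (T.nofold hcon hc v hop) hns

end TriCol
end Pregraph

namespace Pregraph

variable {P : Pregraph}

/-- A 4-cycle component through given vertices and edges. -/
def Cyc (P : Pregraph) (F : Set P.E) (v a b c : P.V) (e1 e2 e3 e4 : P.E) : Prop :=
  (v ≠ a ∧ v ≠ b ∧ v ≠ c ∧ a ≠ b ∧ a ≠ c ∧ b ≠ c) ∧
  (e1 ≠ e2 ∧ e1 ≠ e3 ∧ e1 ≠ e4 ∧ e2 ≠ e3 ∧ e2 ≠ e4 ∧ e3 ≠ e4) ∧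
  (e1 ∈ F ∧ e2 ∈ F ∧ e3 ∈ F ∧ e4 ∈ F) ∧
  (P.joins e1 v a ∧ P.joins e2 a b ∧ P.joins e3 b c ∧ P.joins e4 c v) ∧
  (∀ e ∈ F, (P.incident e v → e = e1 ∨ e = e4) ∧ (P.incident e a → e = e1 ∨ e = e2) ∧
    (P.incident e b → e = e2 ∨ e = e3) ∧ (P.incident e c → e = e3 ∨ e = e4))

theorem Cyc.rot {F : Set P.E} {v a b c : P.V} {e1 e2 e3 e4 : P.E}
    (h : P.Cyc F v a b c e1 e2 e3 e4) : P.Cyc F a b c v e2 e3 e4 e1 := by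
  obtain ⟨h1, h2, h3, h4, h5⟩ := h
  refine ⟨by grind, by grind, by grind, by tauto, fun e he => ?_⟩
  have := h5 e he
  tauto

theorem Cyc.refl {F : Set P.E} {v a b c : P.V} {e1 e2 e3 e4 : P.E}
    (h : P.Cyc F v a b c e1 e2 e3 e4) : P.Cyc F v c b a e4 e3 e2 e1 := by
  obtain ⟨h1, h2, h3, h4, h5⟩ := h
  refine ⟨by grind, by grind, by grind, ?_, fun e he => ?_⟩
  · exact ⟨joins_comm h4.2.2.2, joins_comm h4.2.2.1, joins_comm h4.2.1, joins_comm h4.1⟩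
  · have := h5 e he
    tauto

/-- The local structure of a factor at a vertex. -/
inductive Loc (P : Pregraph) (F : Set P.E) (v : P.V) : Prop
  | cyc (a b c : P.V) (e1 e2 e3 e4 : P.E) (h : P.Cyc F v a b c e1 e2 e3 e4) : Loc P F v
  | dig (a : P.V) (e1 e2 : P.E) (hv : v ≠ a) (he : e1 ≠ e2) (h1 : e1 ∈ F) (h2 : e2 ∈ F)
      (j1 : P.joins e1 v a) (j2 : P.joins e2 v a)
      (u : ∀ e ∈ F, P.incident e v ∨ P.incident e a → e = e1 ∨ e = e2) : Loc P F v
  | bar (a : P.V) (e1 e2 e3 : P.E) (hv : v ≠ a) (h12 : e1 ≠ e2) (h13 : e1 ≠ e3) (h23 : e2 ≠ e3)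
      (h1 : e1 ∈ F) (h2 : e2 ∈ F) (h3 : e3 ∈ F)
      (j1 : P.joins e1 v a) (j2 : P.ends e2 = .semi v) (j3 : P.ends e3 = .semi a)
      (u : ∀ e ∈ F, P.incident e v → e = e1 ∨ e = e2)
      (u' : ∀ e ∈ F, P.incident e a → e = e1 ∨ e = e3) : Loc P F v
  | pt (e1 e2 : P.E) (he : e1 ≠ e2) (h1 : e1 ∈ F) (h2 : e2 ∈ F)
      (j1 : P.ends e1 = .semi v) (j2 : P.ends e2 = .semi v)
      (u : ∀ e ∈ F, P.incident e v → e = e1 ∨ e = e2) : Loc P F v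

theorem loc_of_factor {F : Set P.E} (hF : P.IsCQFactor F) (v : P.V) : P.Loc F v := by
  obtain ⟨Ps, hcomp, hcov, _⟩ := hF
  obtain ⟨C, hC, hvC⟩ := hcov v
  have key : ∀ S : Set P.E, {e ∈ F | P.touches e C} = S →
      (∀ e ∈ S, e ∈ F) ∧ (∀ e ∈ F, ∀ w ∈ C, P.incident e w → e ∈ S) := by
    rintro S rfl
    exact ⟨fun e he => he.1, fun e he w hw hi => ⟨he, touches_iff.2 ⟨w, hw, hi⟩⟩⟩
  rcases hcomp C hC with h | h | h | h
  · obtain ⟨a, b, c, d, h1, h2, h3, h4, h5, h6, rfl, e1, e2, e3, e4, k1, k2, k3, k4, k5, k6, hS,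
      j1, j2, j3, j4⟩ := h
    obtain ⟨hm, hu⟩ := key _ hS
    have hcy : P.Cyc F a b c d e1 e2 e3 e4 := by
      refine ⟨⟨h1, h2, h3, h4, h5, h6⟩, ⟨k1, k2, k3, k4, k5, k6⟩,
        ⟨hm _ (by simp), hm _ (by simp), hm _ (by simp), hm _ (by simp)⟩, ⟨j1, j2, j3, j4⟩, ?_⟩
      intro e he
      have A : ∀ w ∈ ({a, b, c, d} : Set P.V), P.incident e w →
          e = e1 ∨ e = e2 ∨ e = e3 ∨ e = e4 := fun w hw hi => by
        simpa using hu e he w hw hi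
      refine ⟨fun hi => ?_, fun hi => ?_, fun hi => ?_, fun hi => ?_⟩
      · rcases A _ (by simp) hi with rfl | rfl | rfl | rfl
        · simp
        · rcases eq_of_incident_joins j2 hi with h | h <;> simp_all
        · rcases eq_of_incident_joins j3 hi with h | h <;> simp_all
        · simp
      · rcases A _ (by simp) hi with rfl | rfl | rfl | rfl
        · simp
        · simp
        · rcases eq_of_incident_joins j3 hi with h | h <;> simp_all
        · rcases eq_of_incident_joins j4 hi with h | h <;> simp_all
      · rcases A _ (by simp) hi with rfl | rfl | rfl | rfl
        · rcases eq_of_incident_joins j1 hi with h | h <;> simp_all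
        · simp
        · simp
        · rcases eq_of_incident_joins j4 hi with h | h <;> simp_all
      · rcases A _ (by simp) hi with rfl | rfl | rfl | rfl
        · rcases eq_of_incident_joins j1 hi with h | h <;> simp_all
        · rcases eq_of_incident_joins j2 hi with h | h <;> simp_all
        · simp
        · simp
    rcases hvC with rfl | rfl | rfl | rfl
    · exact .cyc _ _ _ _ _ _ _ hcy
    · exact .cyc _ _ _ _ _ _ _ hcy.rot
    · exact .cyc _ _ _ _ _ _ _ hcy.rot.rot
    · exact .cyc _ _ _ _ _ _ _ hcy.rot.rot.rot
  · obtain ⟨a, b, hab, rfl, e1, e2, he, hS, j1, j2⟩ := h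
    obtain ⟨hm, hu⟩ := key _ hS
    rcases hvC with rfl | rfl
    · refine .dig b e1 e2 hab he (hm _ (by simp)) (hm _ (by simp)) j1 j2 ?_
      rintro e he (hi | hi)
      · simpa using hu e he _ (by simp) hi
      · simpa using hu e he _ (by simp) hi
    · refine .dig a e1 e2 hab.symm he (hm _ (by simp)) (hm _ (by simp))
        (joins_comm j1) (joins_comm j2) ?_
      rintro e he (hi | hi)
      · simpa using hu e he _ (by simp) hi
      · simpa using hu e he _ (by simp) hi
  · obtain ⟨a, b, hab, rfl, e1, e2, e3, k1, k2, k3, hS, j1, j2, j3⟩ := h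
    obtain ⟨hm, hu⟩ := key _ hS
    have ua : ∀ e ∈ F, P.incident e a → e = e1 ∨ e = e2 := by
      intro e he hi
      have : e = e1 ∨ e = e2 ∨ e = e3 := by simpa using hu e he a (by simp) hi
      rcases this with rfl | rfl | rfl
      · simp
      · simp
      · exact absurd (eq_of_incident_semi j3 hi).symm hab
    have ub : ∀ e ∈ F, P.incident e b → e = e1 ∨ e = e3 := by
      intro e he hi
      have : e = e1 ∨ e = e2 ∨ e = e3 := by simpa using hu e he b (by simp) hi
      rcases this with rfl | rfl | rfl
      · simp
      · exact absurd (eq_of_incident_semi j2 hi) hab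
      · simp
    rcases hvC with rfl | rfl
    · exact .bar b e1 e2 e3 hab k1 k2 k3 (hm _ (by simp)) (hm _ (by simp)) (hm _ (by simp))
        j1 j2 j3 ua ub
    · exact .bar a e1 e3 e2 hab.symm k2 k1 k3.symm (hm _ (by simp)) (hm _ (by simp))
        (hm _ (by simp)) (joins_comm j1) j3 j2 ub ua
  · obtain ⟨a, rfl, e1, e2, he, hS, j1, j2⟩ := h
    obtain ⟨hm, hu⟩ := key _ hS
    have hva : v = a := hvC
    subst hva
    exact .pt e1 e2 he (hm _ (by simp)) (hm _ (by simp)) j1 j2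
      (fun e he hi => by simpa using hu e he _ (by simp) hi)

theorem joins_not_semi {e : P.E} {a b c : P.V} (h : P.joins e a b) (h' : P.ends e = .semi c) :
    False := by
  rcases h with h | h <;> rw [h'] at h <;> cases h

/-- Opposite edges in a component, along a proper edge. -/
theorem locL {F : Set P.E} (hF : P.IsCQFactor F) {v a : P.V} {f g : P.E} (hg : g ∈ F)
    (hj : P.joins g v a) (hf : f ∈ F) (hfg : f ≠ g) (hfv : P.incident f v) :
    ∃ k ∈ F, k ≠ g ∧ P.incident k a ∧ (∀ k' ∈ F, k' ≠ g → P.incident k' a → k' = k) ∧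
      ((f = k ∧ P.joins f v a) ∨ (P.ends f = .semi v ∧ P.ends k = .semi a) ∨
        ∃ b c l, P.joins f v c ∧ P.joins k a b ∧ P.joins l b c ∧ l ∈ F ∧
          l ≠ f ∧ l ≠ g ∧ l ≠ k ∧ v ≠ b ∧ a ≠ c ∧ b ≠ c) := by
  cases loc_of_factor hF v with
  | cyc a' b c e1 e2 e3 e4 h =>
    have main : ∀ a' b c e1 e2 e3 e4, P.Cyc F v a' b c e1 e2 e3 e4 → g = e1 →
      ∃ k ∈ F, k ≠ g ∧ P.incident k a ∧ (∀ k' ∈ F, k' ≠ g → P.incident k' a → k' = k) ∧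
      ((f = k ∧ P.joins f v a) ∨ (P.ends f = .semi v ∧ P.ends k = .semi a) ∨
        ∃ b c l, P.joins f v c ∧ P.joins k a b ∧ P.joins l b c ∧ l ∈ F ∧
          l ≠ f ∧ l ≠ g ∧ l ≠ k ∧ v ≠ b ∧ a ≠ c ∧ b ≠ c) := by
      rintro a' b c e1 e2 e3 e4 ⟨h1, h2, h3, h4, h5⟩ rfl
      have ha : a = a' := joins_right_unique hj h4.1
      subst ha
      have hf4 : f = e4 := by
        rcases (h5 f hf).1 hfv with h | h
        · exact absurd h hfg
        · exact h
      subst hf4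
      refine ⟨e2, h3.2.1, h2.1.symm, incident_of_joins h4.2.1, ?_, Or.inr (Or.inr ?_)⟩
      · intro k' hk' hne hi
        rcases (h5 k' hk').2.1 hi with h | h
        · exact absurd h hne
        · exact h
      · exact ⟨b, c, e3, joins_comm h4.2.2.2, h4.2.1, h4.2.2.1, h3.2.2.1, by tauto, by tauto,
          by tauto, by tauto, by tauto, by tauto⟩
    rcases (h.2.2.2.2 g hg).1 (incident_of_joins hj) with h1 | h1
    · exact main _ _ _ _ _ _ _ h h1
    · exact main _ _ _ _ _ _ _ h.refl h1
  | dig a' e1 e2 hv he h1 h2 j1 j2 u =>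
    have hg' := u g hg (Or.inl (incident_of_joins hj))
    have hf' := u f hf (Or.inl hfv)
    have ha : a' = a := by
      rcases hg' with rfl | rfl
      · exact joins_right_unique j1 hj
      · exact joins_right_unique j2 hj
    subst ha
    have hfj : P.joins f v a' := by rcases hf' with rfl | rfl <;> assumption
    refine ⟨f, hf, hfg, incident_of_joins (joins_comm hfj), ?_, Or.inl ⟨rfl, hfj⟩⟩
    intro k' hk' hne hi
    have := u k' hk' (Or.inr hi)
    grind
  | bar a' e1 e2 e3 hv h12 h13 h23 h1 h2 h3 j1 j2 j3 u u' =>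
    have hg' : g = e1 := by
      rcases u g hg (incident_of_joins hj) with h | h
      · exact h
      · subst h; exact (joins_not_semi hj j2).elim
    subst hg'
    have hf' : f = e2 := by
      rcases u f hf hfv with h | h
      · exact absurd h hfg
      · exact h
    subst hf'
    have ha : a' = a := joins_right_unique j1 hj
    subst ha
    refine ⟨e3, h3, h13.symm, incident_of_semi j3, ?_, Or.inr (Or.inl ⟨j2, j3⟩)⟩
    intro k' hk' hne hi
    rcases u' k' hk' hi with h | h
    · exact absurd h hne
    · exact h
  | pt e1 e2 he h1 h2 j1 j2 u =>
    rcases u g hg (incident_of_joins hj) with h | h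
    · subst h; exact (joins_not_semi hj j1).elim
    · subst h; exact (joins_not_semi hj j2).elim

/-- Structure of a component at a semi-edge. -/
theorem locS {F : Set P.E} (hF : P.IsCQFactor F) {v : P.V} {f g : P.E} (hg : g ∈ F)
    (hj : P.ends g = .semi v) (hf : f ∈ F) (hfg : f ≠ g) (hfv : P.incident f v) :
    P.ends f = .semi v ∨ ∃ a k, a ≠ v ∧ P.joins f v a ∧ k ∈ F ∧ k ≠ f ∧ P.ends k = .semi a := by
  cases loc_of_factor hF v with
  | cyc a' b c e1 e2 e3 e4 h =>
    rcases (h.2.2.2.2 g hg).1 (incident_of_semi hj) with h1 | h1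
    · subst h1; exact (joins_not_semi h.2.2.2.1.1 hj).elim
    · subst h1; exact (joins_not_semi h.2.2.2.1.2.2.2 hj).elim
  | dig a' e1 e2 hv he h1 h2 j1 j2 u =>
    rcases u g hg (Or.inl (incident_of_semi hj)) with h | h
    · subst h; exact (joins_not_semi j1 hj).elim
    · subst h; exact (joins_not_semi j2 hj).elim
  | bar a' e1 e2 e3 hv h12 h13 h23 h1 h2 h3 j1 j2 j3 u u' =>
    have hg' : g = e2 := by
      rcases u g hg (incident_of_semi hj) with h | h
      · subst h; exact (joins_not_semi j1 hj).elim
      · exact h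
    have hf' : f = e1 := by
      rcases u f hf hfv with h | h
      · exact h
      · exact absurd (h.trans hg'.symm) hfg
    subst hf'
    exact Or.inr ⟨a', e3, hv.symm, j1, h3, h13.symm, j3⟩
  | pt e1 e2 he h1 h2 j1 j2 u =>
    left
    rcases u f hf hfv with h | h <;> subst h <;> assumption

theorem endCount_pos_iff {v : P.V} {e : P.E} : P.endCount v e ≠ 0 ↔ P.incident e v := by
  unfold endCount incident
  rcases P.ends e with ⟨a, b⟩ | a <;> simp only
  · by_cases h1 : a = v <;> by_cases h2 : b = v <;> simp [h1, h2]
  · by_cases h1 : a = v <;> simp [h1]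

theorem endCount_joins {a b : P.V} {e : P.E} (hab : a ≠ b) (h : P.joins e a b) :
    P.endCount a e = 1 := by
  unfold endCount
  rcases h with h | h <;> simp [h, hab.symm]

theorem endCount_semi {a : P.V} {e : P.E} (h : P.ends e = .semi a) :
    P.endCount a e = 1 := by
  unfold endCount
  simp [h]

theorem end_cases {v : P.V} {e : P.E} (h : P.endCount v e = 1) :
    P.ends e = .semi v ∨ ∃ w, w ≠ v ∧ P.joins e v w := by
  unfold endCount at h
  unfold joins
  rcases he : P.ends e with ⟨a, b⟩ | a <;> rw [he] at h <;> simp only at h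
  · right
    by_cases h1 : a = v <;> by_cases h2 : b = v <;> simp [h1, h2] at h
    · subst h1; exact ⟨b, h2, Or.inl rfl⟩
    · subst h2; exact ⟨a, h1, Or.inr rfl⟩
  · left
    by_cases h1 : a = v <;> simp [h1] at h
    rw [h1]

theorem locTwo {F : Set P.E} (hF : P.IsCQFactor F) (v : P.V) :
    ∃ f g, f ≠ g ∧ f ∈ F ∧ g ∈ F ∧ P.endCount v f = 1 ∧ P.endCount v g = 1 ∧
      ∀ e ∈ F, P.incident e v → e = f ∨ e = g := by
  cases loc_of_factor hF v with
  | cyc a' b c e1 e2 e3 e4 h =>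
    obtain ⟨h1, h2, h3, h4, h5⟩ := h
    exact ⟨e1, e4, by tauto, by tauto, by tauto, endCount_joins h1.1 h4.1,
      endCount_joins h1.2.2.1 (joins_comm h4.2.2.2), fun e he => (h5 e he).1⟩
  | dig a' e1 e2 hv he h1 h2 j1 j2 u =>
    exact ⟨e1, e2, he, h1, h2, endCount_joins hv j1, endCount_joins hv j2,
      fun e he hi => u e he (Or.inl hi)⟩
  | bar a' e1 e2 e3 hv h12 h13 h23 h1 h2 h3 j1 j2 j3 u u' =>
    exact ⟨e1, e2, h12, h1, h2, endCount_joins hv j1, endCount_semi j2, u⟩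
  | pt e1 e2 he h1 h2 j1 j2 u =>
    exact ⟨e1, e2, he, h1, h2, endCount_semi j1, endCount_semi j2, u⟩

/-- The three edges at a vertex of a cubic pregraph with a factor. -/
theorem locThree (hP : P.Cubic) {F : Set P.E} (hF : P.IsCQFactor F) (v : P.V) :
    ∃ f g h, f ≠ g ∧ f ≠ h ∧ g ≠ h ∧ f ∈ F ∧ g ∈ F ∧ h ∉ F ∧
      P.endCount v f = 1 ∧ P.endCount v g = 1 ∧ P.endCount v h = 1 ∧
      ∀ e, P.incident e v → e = f ∨ e = g ∨ e = h := by
  obtain ⟨f, g, hfg, hf, hg, cf, cg, hu⟩ := locTwo hF v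
  have hd := hP.2 v
  unfold degree at hd
  rw [← Finset.add_sum_erase _ _ (Finset.mem_univ f),
    ← Finset.add_sum_erase _ _ (show g ∈ Finset.univ.erase f by simp [hfg.symm]), cf, cg] at hd
  have hd1 : ∑ x ∈ (Finset.univ.erase f).erase g, P.endCount v x = 1 := by omega
  obtain ⟨h, hh, h0⟩ := Finset.exists_ne_zero_of_sum_ne_zero (by rw [hd1]; exact one_ne_zero)
  rw [← Finset.add_sum_erase _ _ hh] at hd1
  have hh' : h ≠ g ∧ h ≠ f := by simpa using hh
  have ch : P.endCount v h = 1 := by omega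
  have hd2 : ∑ x ∈ ((Finset.univ.erase f).erase g).erase h, P.endCount v x = 0 := by omega
  rw [Finset.sum_eq_zero_iff] at hd2
  refine ⟨f, g, h, hfg, hh'.2.symm, hh'.1.symm, hf, hg, ?_, cf, cg, ch, ?_⟩
  · intro hF'
    rcases hu h hF' (endCount_pos_iff.1 h0) with h | h
    · exact hh'.2 h
    · exact hh'.1 h
  · intro e he
    by_contra hcon
    push Not at hcon
    exact endCount_pos_iff.2 he (hd2 e (by simp [hcon]))

end Pregraph

namespace Pregraph

variable {P : Pregraph}

/-- Edges with the same ends. -/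
def Twin (P : Pregraph) (e f : P.E) : Prop :=
  (∃ v, P.ends e = .semi v ∧ P.ends f = .semi v) ∨ ∃ v w, P.joins e v w ∧ P.joins f v w

theorem endsRel_id_comm {x y : PEnds P.V} (h : endsRel id x y) : endsRel id y x := by
  rcases x with ⟨a, b⟩ | a
  · rcases h with rfl | rfl <;> simp [endsRel]
  · cases h; simp [endsRel]

theorem endsRel_id_refl (x : PEnds P.V) : endsRel id x x := by
  rcases x with ⟨a, b⟩ | a <;> simp [endsRel]

theorem Twin.rel {e f : P.E} (h : P.Twin e f) : endsRel id (P.ends e) (P.ends f) := by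
  rcases h with ⟨v, h1, h2⟩ | ⟨v, w, h1 | h1, h2 | h2⟩ <;> rw [h1, h2] <;> simp [endsRel]

theorem twin_rel {e f : P.E} (h : P.Twin e f) (x : P.E) :
    endsRel id (P.ends x) (P.ends (Equiv.swap e f x)) := by
  by_cases h1 : x = e
  · subst h1; rw [Equiv.swap_apply_left]; exact h.rel
  by_cases h2 : x = f
  · subst h2; rw [Equiv.swap_apply_right]; exact endsRel_id_comm h.rel
  · rw [Equiv.swap_apply_of_ne_of_ne h1 h2]; exact endsRel_id_refl _

/-- The automorphism exchanging two twin edges. -/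
def twinIso {e f : P.E} (h : P.Twin e f) : Iso P P where
  vmap := Equiv.refl _
  emap := Equiv.swap e f
  compat := twin_rel h

theorem twin_joins {e f : P.E} (h : P.Twin e f) {x : P.E} {a b : P.V} (hx : P.joins x a b) :
    P.joins (Equiv.swap e f x) a b := by
  have := twin_rel h x
  unfold joins at *
  rcases hx with hx | hx <;> rw [hx] at this
  · exact this
  · exact Or.symm this

theorem twin_semi {e f : P.E} (h : P.Twin e f) {x : P.E} {a : P.V} (hx : P.ends x = .semi a) :
    P.ends (Equiv.swap e f x) = .semi a := by
  have := twin_rel h x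
  rw [hx] at this
  exact this

theorem twin_touches {e f : P.E} (h : P.Twin e f) {x : P.E} {C : Set P.V} :
    P.touches (Equiv.swap e f x) C ↔ P.touches x C := by
  have := twin_rel h x
  unfold touches
  rcases hx : P.ends x with ⟨a, b⟩ | a <;> rw [hx] at this
  · rcases this with h1 | h1 <;> rw [h1] <;> simp only [id]
    exact or_comm
  · have h1 : P.ends (Equiv.swap e f x) = .semi a := this
    rw [h1]

theorem iso_factor {e f : P.E} (h : P.Twin e f) {F : Set P.E} (hF : P.IsCQFactor F) :
    P.IsCQFactor {x | Equiv.swap e f x ∈ F} := by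
  obtain ⟨Ps, h1, h2, h3⟩ := hF
  refine ⟨Ps, fun C hC => ?_, h2, h3⟩
  set s := Equiv.swap e f with hs
  have ss : ∀ x, s (s x) = x := fun x => Equiv.swap_apply_self e f x
  have key : ∀ x, x ∈ {y ∈ {x | s x ∈ F} | P.touches y C} ↔ s x ∈ {y ∈ F | P.touches y C} := by
    intro x
    simp only [Set.mem_setOf_eq]
    rw [hs, twin_touches h]
  have sw : ∀ x y, s x = y ↔ x = s y := by
    intro x y; constructor
    · rintro rfl; exact (ss x).symm
    · rintro rfl; exact ss y
  have ne : ∀ {x y}, x ≠ y → s x ≠ s y := fun hxy h => hxy (s.injective h)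
  rcases h1 C hC with h | h | h | h
  · obtain ⟨a, b, c, d, h1, h2, h3, h4, h5, h6, hC, e1, e2, e3, e4, k1, k2, k3, k4, k5, k6, hS,
      j1, j2, j3, j4⟩ := h
    refine Or.inl ⟨a, b, c, d, h1, h2, h3, h4, h5, h6, hC, s e1, s e2, s e3, s e4, ne k1, ne k2,
      ne k3, ne k4, ne k5, ne k6, ?_, twin_joins ‹_› j1, twin_joins ‹_› j2, twin_joins ‹_› j3,
      twin_joins ‹_› j4⟩
    ext x; rw [key, hS]; simp [sw]
  · obtain ⟨a, b, hab, hC, e1, e2, he, hS, j1, j2⟩ := h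
    refine Or.inr (Or.inl ⟨a, b, hab, hC, s e1, s e2, ne he, ?_, twin_joins ‹_› j1,
      twin_joins ‹_› j2⟩)
    ext x; rw [key, hS]; simp [sw]
  · obtain ⟨a, b, hab, hC, e1, e2, e3, k1, k2, k3, hS, j1, j2, j3⟩ := h
    refine Or.inr (Or.inr (Or.inl ⟨a, b, hab, hC, s e1, s e2, s e3, ne k1, ne k2, ne k3, ?_,
      twin_joins ‹_› j1, twin_semi ‹_› j2, twin_semi ‹_› j3⟩))
    ext x; rw [key, hS]; simp [sw]
  · obtain ⟨a, hC, e1, e2, he, hS, j1, j2⟩ := h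
    refine Or.inr (Or.inr (Or.inr ⟨a, hC, s e1, s e2, ne he, ?_, twin_semi ‹_› j1,
      twin_semi ‹_› j2⟩))
    ext x; rw [key, hS]; simp [sw]

theorem factorIso_twin {e f : P.E} (h : P.Twin e f) {F1 F2 : Set P.E}
    (hi : FactorIso P F1 {x | Equiv.swap e f x ∈ F2}) : FactorIso P F1 F2 := by
  obtain ⟨φ, hφ⟩ := hi
  refine ⟨⟨φ.vmap, φ.emap.trans (Equiv.swap e f), fun x => ?_⟩, fun x => (hφ x).trans Iff.rfl⟩
  have h1 := φ.compat x
  have h2 := twin_rel h (φ.emap x)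
  simp only [Equiv.trans_apply]
  rcases hx : P.ends x with ⟨a, b⟩ | a <;> rw [hx] at h1
  · rcases h1 with h1 | h1 <;> rw [h1] at h2
    · exact h2
    · exact Or.symm h2
  · have h1' : P.ends (φ.emap x) = .semi (φ.vmap a) := h1
    rw [h1'] at h2; exact h2

/-- No twin pair can be exchanged to make the factors closer. -/
def NoTwin (P : Pregraph) (F1 F2 : Set P.E) : Prop :=
  ∀ e f, e ∉ F1 → f ∈ F1 → e ∈ F2 → f ∉ F2 → ¬ P.Twin e f

theorem exists_noTwin {F1 F2 : Set P.E} (h2 : P.IsCQFactor F2) (hn : ¬ FactorIso P F1 F2) :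
    ∃ F2', P.IsCQFactor F2' ∧ ¬ FactorIso P F1 F2' ∧ P.NoTwin F1 F2' := by
  induction hN : Set.ncard {x | ¬ (x ∈ F1 ↔ x ∈ F2)} using Nat.strong_induction_on
    generalizing F2 with
  | _ N ih =>
    by_cases hT : P.NoTwin F1 F2
    · exact ⟨F2, h2, hn, hT⟩
    · unfold NoTwin at hT
      push Not at hT
      obtain ⟨e, f, e1, f1, e2, f2, ht⟩ := hT
      refine ih _ ?_ (iso_factor ht h2) (fun h => hn (factorIso_twin ht h)) rfl
      rw [← hN]
      apply Set.ncard_lt_ncard _ (Set.toFinite _)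
      refine ⟨fun x hx => ?_, fun hsub => ?_⟩
      · by_cases hxe : x = e
        · subst hxe; simp [e1, f2] at hx
        by_cases hxf : x = f
        · subst hxf; simp [f1, e2] at hx
        simpa [Equiv.swap_apply_of_ne_of_ne hxe hxf] using hx
      · have := hsub (show e ∈ {x | ¬ (x ∈ F1 ↔ x ∈ F2)} by simp [e1, e2])
        simp [e1, f2] at this

/-- Uniqueness of the missing edge. -/
theorem miss_unique (hP : P.Cubic) {F : Set P.E} (hF : P.IsCQFactor F) {v : P.V} {x y : P.E}
    (hx : x ∉ F) (hy : y ∉ F) (ix : P.incident x v) (iy : P.incident y v) : x = y := by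
  obtain ⟨f, g, h, _, _, _, hf, hg, hh, _, _, _, hu⟩ := locThree hP hF v
  grind

theorem miss_exists (hP : P.Cubic) {F : Set P.E} (hF : P.IsCQFactor F) (v : P.V) :
    ∃ h, h ∉ F ∧ P.incident h v := by
  obtain ⟨f, g, h, _, _, _, hf, hg, hh, _, _, c, hu⟩ := locThree hP hF v
  exact ⟨h, hh, endCount_pos_iff.1 (by omega)⟩

theorem no_three (hP : P.Cubic) {F : Set P.E} (hF : P.IsCQFactor F) {v : P.V} {x y z : P.E}
    (hx : x ∈ F) (hy : y ∈ F) (hz : z ∈ F) (ix : P.incident x v) (iy : P.incident y v)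
    (iz : P.incident z v) : x = y ∨ x = z ∨ y = z := by
  obtain ⟨f, g, _, hf, hg, _, _, hu⟩ := locTwo hF v
  have := hu x hx ix
  have := hu y hy iy
  have := hu z hz iz
  grind

/-- The missing edges at `v` differ. -/
def Dif (P : Pregraph) (F1 F2 : Set P.E) (v : P.V) : Prop :=
  ∃ e, P.incident e v ∧ e ∉ F1 ∧ e ∈ F2

theorem Dif.symm (hP : P.Cubic) {F1 F2 : Set P.E} (h1 : P.IsCQFactor F1) (h2 : P.IsCQFactor F2)
    {v : P.V} (h : P.Dif F1 F2 v) : P.Dif F2 F1 v := by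
  obtain ⟨e, ie, e1, e2⟩ := h
  obtain ⟨f, f2, jf⟩ := miss_exists hP h2 v
  refine ⟨f, jf, f2, ?_⟩
  by_contra hf
  have := miss_unique hP h1 e1 hf ie jf
  subst this; exact f2 e2

theorem dif_step (hP : P.Cubic) {F1 F2 : Set P.E} (h1 : P.IsCQFactor F1) (h2 : P.IsCQFactor F2)
    (hT : P.NoTwin F1 F2) {v a : P.V} (hv : P.Dif F1 F2 v) (hadj : P.Adj v a) :
    P.Dif F1 F2 a := by
  obtain ⟨f, jf, f2, f1⟩ := hv.symm hP h1 h2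
  obtain ⟨e, je, e1, e2⟩ := hv
  obtain ⟨g, hg⟩ := hadj
  have gv := incident_of_joins hg
  have ga := incident_of_joins (joins_comm hg)
  by_cases g1 : g ∈ F1
  swap
  · have := miss_unique hP h1 e1 g1 je gv
    subst this
    exact ⟨e, ga, e1, e2⟩
  by_cases g2 : g ∈ F2
  swap
  · have : P.Dif F2 F1 a := ⟨g, ga, g2, g1⟩
    exact this.symm hP h2 h1
  by_contra hD
  have hsame : ∀ x, P.incident x a → (x ∈ F1 ↔ x ∈ F2) := by
    intro x hx
    constructor
    · intro x1
      by_contra x2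
      exact hD (Dif.symm hP h2 h1 ⟨x, hx, x2, x1⟩)
    · intro x2
      by_contra x1
      exact hD ⟨x, hx, x1, x2⟩
  have hfg : f ≠ g := by rintro rfl; exact f2 g2
  have heg : e ≠ g := by rintro rfl; exact e1 g1
  obtain ⟨k, k1, kg, ka, ku, hk⟩ := locL h1 g1 hg f1 hfg jf
  obtain ⟨k', k2', kg', ka', ku', hk'⟩ := locL h2 g2 hg e2 heg je
  have k2 : k ∈ F2 := (hsame k ka).1 k1
  have hkk : k = k' := ku' k k2 kg ka
  subst hkk
  rcases hk with ⟨rfl, _⟩ | ⟨sf, sk⟩ | ⟨b, c, l, jf', jk, jl, l1, lf, lg, lk, _, _, _⟩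
  · exact f2 k2
  · rcases hk' with ⟨rfl, _⟩ | ⟨se, sk'⟩ | ⟨b, c, l, jf', jk, _⟩
    · exact e1 k1
    · exact hT e f e1 f1 e2 f2 (Or.inl ⟨v, se, sf⟩)
    · exact joins_not_semi jk sk
  · rcases hk' with ⟨rfl, _⟩ | ⟨se, sk'⟩ | ⟨b', c', l', je', jk', jl', l2', le, lg', lk', _, _, _⟩
    · exact e1 k1
    · exact joins_not_semi jk sk'
    · have hb : b = b' := joins_right_unique jk jk'
      subst hb
      by_cases hc : c = c'
      · subst hc
        exact hT e f e1 f1 e2 f2 (Or.inr ⟨v, c, je', jf'⟩)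
      · have hll : l ≠ l' := by
          rintro rfl; exact hc (joins_right_unique jl jl')
        by_cases l2 : l ∈ F2
        · rcases no_three hP h2 k2 l2 l2' (incident_of_joins (joins_comm jk))
            (incident_of_joins jl) (incident_of_joins jl') with h | h | h
          · exact lk h.symm
          · exact lk' h.symm
          · exact hll h
        · exact lf (miss_unique hP h2 l2 f2 (incident_of_joins (joins_comm jl))
            (incident_of_joins (joins_comm jf')))

theorem dif_all (hP : P.Cubic) {F1 F2 : Set P.E} (h1 : P.IsCQFactor F1) (h2 : P.IsCQFactor F2)
    (hT : P.NoTwin F1 F2) (hn : ¬ FactorIso P F1 F2) (v : P.V) : P.Dif F1 F2 v := by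
  have hex : ∃ u, P.Dif F1 F2 u := by
    by_contra hno
    push Not at hno
    apply hn
    refine ⟨⟨Equiv.refl _, Equiv.refl _, fun x => endsRel_id_refl _⟩, fun x => ?_⟩
    obtain ⟨u, hu⟩ := exists_incident x
    constructor
    · intro x1
      by_contra x2
      exact hno u (Dif.symm hP h2 h1 ⟨x, hu, x2, x1⟩)
    · intro x2
      by_contra x1
      exact hno u ⟨x, hu, x1, x2⟩
  obtain ⟨u, hu⟩ := hex
  have := hP.1 u v
  induction this with
  | refl => exact hu
  | tail _ h ih => exact dif_step hP h1 h2 hT ih h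

theorem exists_tri (hP : P.Cubic) {F1 F2 : Set P.E} (h1 : P.IsCQFactor F1)
    (h2 : P.IsCQFactor F2) (hD : ∀ v, P.Dif F1 F2 v) :
    ∃ T : TriCol P, F1 = T.avoid 0 ∧ F2 = T.avoid 1 := by
  classical
  have hdisj : ∀ e, e ∉ F1 → e ∈ F2 := by
    intro e e1
    obtain ⟨v, hv⟩ := exists_incident e
    obtain ⟨e', he', e1', e2'⟩ := hD v
    rw [miss_unique hP h1 e1 e1' hv he']; exact e2'
  let col : P.E → Fin 3 := fun e => if e ∉ F1 then 0 else if e ∉ F2 then 1 else 2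
  have c0 : ∀ e, col e = 0 ↔ e ∉ F1 := by
    intro e; simp only [col]; split_ifs <;> simp_all
  have c1 : ∀ e, col e = 1 ↔ e ∉ F2 := by
    intro e; have := hdisj e; simp only [col]; split_ifs <;> simp_all
  have c2 : ∀ e, col e = 2 ↔ e ∈ F1 ∧ e ∈ F2 := by
    intro e; have := hdisj e; simp only [col]; split_ifs <;> simp_all
  have hed : ∀ v i, ∃ e, col e = i ∧ P.endCount v e = 1 ∧
      ∀ e', P.incident e' v → col e' = i → e' = e := by
    intro v
    obtain ⟨f, g, h, hfg, hfh, hgh, hf, hg, hh, cf, cg, ch, hu⟩ := locThree hP h1 v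
    have jf : P.incident f v := endCount_pos_iff.1 (by omega)
    have jg : P.incident g v := endCount_pos_iff.1 (by omega)
    have jh : P.incident h v := endCount_pos_iff.1 (by omega)
    have hh2 := hdisj h hh
    obtain ⟨x, x2, hx⟩ := miss_exists hP h2 v
    have main : ∀ f g, f ≠ g → f ∈ F1 → g ∈ F1 → P.incident f v → P.incident g v →
        P.endCount v f = 1 → P.endCount v g = 1 →
        (∀ e, P.incident e v → e = f ∨ e = g ∨ e = h) → f ∉ F2 →
        ∀ i, ∃ e, col e = i ∧ P.endCount v e = 1 ∧
          ∀ e', P.incident e' v → col e' = i → e' = e := by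
      intro f g hfg hf hg jf jg cf cg hu f2 i
      have g2 : g ∈ F2 := by
        by_contra g2
        exact hfg (miss_unique hP h2 f2 g2 jf jg)
      have i3 : i = 0 ∨ i = 1 ∨ i = 2 := by revert i; decide
      rcases i3 with rfl | rfl | rfl
      · exact ⟨h, (c0 h).2 hh, ch, fun e' hi hc =>
          miss_unique hP h1 ((c0 e').1 hc) hh hi jh⟩
      · exact ⟨f, (c1 f).2 f2, cf, fun e' hi hc =>
          miss_unique hP h2 ((c1 e').1 hc) f2 hi jf⟩
      · refine ⟨g, (c2 g).2 ⟨hg, g2⟩, cg, fun e' hi hc => ?_⟩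
        have := (c2 e').1 hc
        rcases hu e' hi with rfl | rfl | rfl
        · exact absurd this.2 f2
        · rfl
        · exact absurd this.1 hh
    rcases hu x hx with rfl | rfl | rfl
    · exact main x g hfg hf hg jf jg cf cg hu x2
    · exact main x f hfg.symm hg hf jg jf cg cf (fun e he => by have := hu e he; tauto) x2
    · exact absurd hh2 x2
  choose ed ec ecount eu using hed
  have hτ : ∀ i v, ∃ w, (w = v ∧ P.ends (ed v i) = .semi v) ∨
      (w ≠ v ∧ P.joins (ed v i) v w) := by
    intro i v
    rcases end_cases (ecount v i) with h | ⟨w, hw, h⟩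
    · exact ⟨v, Or.inl ⟨rfl, h⟩⟩
    · exact ⟨w, Or.inr ⟨hw, h⟩⟩
  choose τ hτ using hτ
  refine ⟨⟨col, ed, τ, ec, fun e v he => eu v _ e he rfl, fun v i => hτ i v⟩, ?_, ?_⟩
  · ext e
    have := c0 e
    simp only [TriCol.avoid, Set.mem_setOf_eq]
    tauto
  · ext e
    have := c1 e
    simp only [TriCol.avoid, Set.mem_setOf_eq]
    tauto

namespace TriCol

variable (T : TriCol P)

theorem τ_of_joins {e : P.E} {v w : P.V} (h : P.joins e v w) : T.τ (T.col e) v = w := by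
  have h1 := T.uniq _ _ (incident_of_joins h)
  rcases T.ends_ed v (T.col e) with ⟨_, h3⟩ | ⟨_, h3⟩ <;> rw [← h1] at h3
  · exact (joins_not_semi h h3).elim
  · exact joins_right_unique h3 h

theorem τ_of_semi {e : P.E} {v : P.V} (h : P.ends e = .semi v) : T.τ (T.col e) v = v := by
  have h1 := T.uniq _ _ (incident_of_semi h)
  rcases T.ends_ed v (T.col e) with ⟨h2, h3⟩ | ⟨_, h3⟩ <;> rw [← h1] at h3
  · exact h2
  · exact (joins_not_semi h3 h).elim

theorem comm_aux {i j : Fin 3} (hi : i ≠ 2) (hj : ∀ k : Fin 3, k ≠ j ↔ k = i ∨ k = 2)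
    (hF : P.IsCQFactor (T.avoid j)) (v : P.V) : T.τ i (T.τ 2 v) = T.τ 2 (T.τ i v) := by
  have mem : ∀ e, e ∈ T.avoid j ↔ T.col e = i ∨ T.col e = 2 := fun e => hj (T.col e)
  have hf : T.ed v i ∈ T.avoid j := (mem _).2 (Or.inl (T.col_ed v i))
  have hg : T.ed v 2 ∈ T.avoid j := (mem _).2 (Or.inr (T.col_ed v 2))
  have hfg : T.ed v i ≠ T.ed v 2 := by
    intro h; have := congrArg T.col h; rw [col_ed, col_ed] at this; exact hi this
  have sameV : ∀ {x y : P.E} {w : P.V}, P.incident x w → P.incident y w →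
      T.col x = T.col y → x = y := by
    intro x y w hx hy h
    rw [T.uniq x w hx, h, ← T.uniq y w hy]
  rcases T.ends_ed v 2 with ⟨h2, hs⟩ | ⟨h2, hjn⟩
  · rw [h2]
    rcases locS hF hg hs hf hfg (T.inc_ed v i) with h | ⟨a, k, hav, hja, hk, hkf, hks⟩
    · have := T.τ_of_semi h
      rw [col_ed] at this
      rw [this, h2]
    · have ha := T.τ_of_joins hja
      rw [col_ed] at ha
      have hk2 : T.col k = 2 := by
        rcases (mem k).1 hk with h | h
        · exact absurd (sameV (incident_of_semi hks) (incident_of_joins (joins_comm hja))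
            (by rw [h, col_ed])) hkf
        · exact h
      have := T.τ_of_semi hks
      rw [hk2] at this
      rw [ha, this]
  · obtain ⟨k, hk, hkg, hka, _, h⟩ := locL hF hg hjn hf hfg (T.inc_ed v i)
    set a := T.τ 2 v with hadef
    have hki : T.col k = i := by
      rcases (mem k).1 hk with h | h
      · exact h
      · exact absurd (sameV hka (incident_of_joins (joins_comm hjn)) (by rw [h, col_ed])) hkg
    rcases h with ⟨hfk, hfa⟩ | ⟨hsf, hsk⟩ | ⟨b, c, l, jf, jk, jl, hl, lf, lg, lk, _, _, _⟩
    · have := T.τ_of_joins hfa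
      rw [col_ed] at this
      have h3 := T.τ_of_joins (joins_comm hfa)
      rw [col_ed] at h3
      rw [this, h3, hadef, τ_τ]
    · have h3 := T.τ_of_semi hsf
      rw [col_ed] at h3
      have h4 := T.τ_of_semi hsk
      rw [hki] at h4
      rw [h3, h4]
    · have h3 := T.τ_of_joins jf
      rw [col_ed] at h3
      have h4 := T.τ_of_joins jk
      rw [hki] at h4
      have hl2 : T.col l = 2 := by
        rcases (mem l).1 hl with h | h
        · exact absurd (sameV (incident_of_joins (joins_comm jl))
            (incident_of_joins (joins_comm jf)) (by rw [h, col_ed])) lf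
        · exact h
      have h5 := T.τ_of_joins (joins_comm jl)
      rw [hl2] at h5
      rw [h3, h4, h5]

end TriCol

theorem concl_of_multiple (hP : P.Cubic) (hne : Nonempty P.V) (hM : HasMultipleCQFactors P) :
    TriCol.Concl P := by
  obtain ⟨F1, F2, h1, h2, hn⟩ := hM
  obtain ⟨F2, h2, hn, hT⟩ := exists_noTwin h2 hn
  obtain ⟨T, rfl, rfl⟩ := exists_tri hP h1 h2 (dif_all hP h1 h2 hT hn)
  refine T.classify hP.1 ?_ ?_ hne
  · intro i v
    have i3 : i = 0 ∨ i = 1 ∨ i = 2 := by revert i; decide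
    rcases i3 with rfl | rfl | rfl
    · exact T.comm_aux (by decide) (by decide) h2 v
    · exact T.comm_aux (by decide) (by decide) h1 v
    · rfl
  · rintro ⟨σ, hσ⟩
    exact hn (T.factorIso_of_equiv σ hσ)

end Pregraph

theorem card_bp (n : ℕ) [h : NeZero n] : Fintype.card (barbedPath n).E = 2 * n + 1 := by
  have h1 : Fintype.card (barbedPath n).E = Fintype.card (Fin (n - 1) ⊕ (Fin n ⊕ Fin 2)) :=
    Fintype.card_congr (Equiv.refl _)
  have := Nat.pos_of_ne_zero h.out
  rw [h1]; simp; omega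

theorem card_dc (m : ℕ) [h : NeZero m] : Fintype.card (dcLadder m).E = 3 * m := by
  have h1 : Fintype.card (dcLadder m).E = Fintype.card ((Fin (m - 1) × Fin 2) ⊕ (Fin m ⊕ Fin 2)) :=
    Fintype.card_congr (Equiv.refl _)
  have := Nat.pos_of_ne_zero h.out
  rw [h1]; simp; omega

theorem card_do (m : ℕ) [h : NeZero m] : Fintype.card (doLadder m).E = 3 * m + 2 := by
  have h1 : Fintype.card (doLadder m).E =
      Fintype.card ((Fin (m - 1) × Fin 2) ⊕ (Fin m ⊕ (Fin 2 × Fin 2))) :=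
    Fintype.card_congr (Equiv.refl _)
  have := Nat.pos_of_ne_zero h.out
  rw [h1]; simp; omega

theorem card_oc (m : ℕ) [h : NeZero m] : Fintype.card (ocLadder m).E = 3 * m + 1 := by
  have h1 : Fintype.card (ocLadder m).E =
      Fintype.card ((Fin (m - 1) × Fin 2) ⊕ (Fin m ⊕ (Unit ⊕ Fin 2))) :=
    Fintype.card_congr (Equiv.refl _)
  have := Nat.pos_of_ne_zero h.out
  rw [h1]; simp; omega

theorem not_iso_of_card {P Q : Pregraph} (h : Fintype.card P.E ≠ Fintype.card Q.E) :
    ¬ Nonempty (Pregraph.Iso P Q) := fun ⟨φ⟩ => h (Fintype.card_congr φ.emap)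

/-- For `n > 0`, the cubic pregraphs on `n` vertices having at
least two pairwise non-isomorphic `C₄`-quotient 2-factors are: none if `n` is odd;
exactly the barbed path, the double-closed ladder, the double-open ladder and the
open-closed ladder on `n` vertices (four pairwise non-isomorphic graphs) if
`n ≡ 0 (mod 4)`; and exactly the barbed path and the open-closed ladder on `n`
vertices (two non-isomorphic graphs) if `n ≡ 2 (mod 4)`. -/
theorem multiple_CQfactors_classification (n : ℕ) (hn : 0 < n) :
    (Odd n → ∀ P : Pregraph, P.Cubic → Fintype.card P.V = n →
      ¬ HasMultipleCQFactors P) ∧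
    (∀ (m : ℕ) (hm : n = 2 * m) (h4 : n % 4 = 0),
      (∀ P : Pregraph, P.Cubic → Fintype.card P.V = n →
        (HasMultipleCQFactors P ↔
          (Nonempty (Pregraph.Iso P (@barbedPath n ⟨by omega⟩)) ∨
           Nonempty (Pregraph.Iso P (@dcLadder m ⟨by omega⟩)) ∨
           Nonempty (Pregraph.Iso P (@doLadder m ⟨by omega⟩)) ∨
           Nonempty (Pregraph.Iso P (@ocLadder m ⟨by omega⟩))))) ∧
      ¬ Nonempty (Pregraph.Iso (@barbedPath n ⟨by omega⟩) (@dcLadder m ⟨by omega⟩)) ∧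
      ¬ Nonempty (Pregraph.Iso (@barbedPath n ⟨by omega⟩) (@doLadder m ⟨by omega⟩)) ∧
      ¬ Nonempty (Pregraph.Iso (@barbedPath n ⟨by omega⟩) (@ocLadder m ⟨by omega⟩)) ∧
      ¬ Nonempty (Pregraph.Iso (@dcLadder m ⟨by omega⟩) (@doLadder m ⟨by omega⟩)) ∧
      ¬ Nonempty (Pregraph.Iso (@dcLadder m ⟨by omega⟩) (@ocLadder m ⟨by omega⟩)) ∧
      ¬ Nonempty (Pregraph.Iso (@doLadder m ⟨by omega⟩) (@ocLadder m ⟨by omega⟩))) ∧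
    (∀ (m : ℕ) (hm : n = 2 * m) (h2 : n % 4 = 2),
      (∀ P : Pregraph, P.Cubic → Fintype.card P.V = n →
        (HasMultipleCQFactors P ↔
          (Nonempty (Pregraph.Iso P (@barbedPath n ⟨by omega⟩)) ∨
           Nonempty (Pregraph.Iso P (@ocLadder m ⟨by omega⟩))))) ∧
      ¬ Nonempty (Pregraph.Iso (@barbedPath n ⟨by omega⟩) (@ocLadder m ⟨by omega⟩))) := by
  have main : ∀ P : Pregraph, P.Cubic → Fintype.card P.V = n → HasMultipleCQFactors P →
      Pregraph.TriCol.Concl P := by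
    intro P hP hc hM
    exact Pregraph.concl_of_multiple hP (Fintype.card_pos_iff.1 (by omega)) hM
  refine ⟨?_, ?_, ?_⟩
  · rintro ⟨q, hq⟩ P hP hc hM
    obtain ⟨m, _, ⟨h1, h2, _⟩ | ⟨h1, _⟩⟩ := main P hP hc hM <;> omega
  · intro m hm h4
    have im : NeZero m := ⟨by omega⟩
    have iN : NeZero n := ⟨by omega⟩
    refine ⟨?_, ?_, ?_, ?_, ?_, ?_, ?_⟩
    · intro P hP hc
      constructor
      · intro hM
        obtain ⟨k, hk, ⟨h1, _, h3⟩ | ⟨h1, h3⟩⟩ := main P hP hc hM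
        · obtain rfl : k = n := by omega
          exact Or.inl h3
        · obtain rfl : k = m := by omega
          rcases h3 with h3 | ⟨_, h3 | h3⟩
          · exact Or.inr (Or.inr (Or.inr h3))
          · exact Or.inr (Or.inr (Or.inl h3))
          · exact Or.inr (Or.inl h3)
      · rintro (⟨⟨φ⟩⟩ | ⟨⟨φ⟩⟩ | ⟨⟨φ⟩⟩ | ⟨⟨φ⟩⟩)
        · exact Pregraph.TriCol.mult_bp n (by omega) φ
        · exact Pregraph.TriCol.mult_dc m (by omega) φ
        · exact Pregraph.TriCol.mult_do m (by omega) φ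
        · exact Pregraph.TriCol.mult_oc m φ
    · exact not_iso_of_card (by rw [card_bp, card_dc]; omega)
    · exact not_iso_of_card (by rw [card_bp, card_do]; omega)
    · exact not_iso_of_card (by rw [card_bp, card_oc]; omega)
    · exact not_iso_of_card (by rw [card_dc, card_do]; omega)
    · exact not_iso_of_card (by rw [card_dc, card_oc]; omega)
    · exact not_iso_of_card (by rw [card_do, card_oc]; omega)
  · intro m hm h2
    refine ⟨?_, ?_⟩
    · intro P hP hc
      constructor
      · intro hM
        obtain ⟨k, hk, ⟨h1, _, h3⟩ | ⟨h1, h3⟩⟩ := main P hP hc hM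
        · obtain rfl : k = n := by omega
          exact Or.inl h3
        · obtain rfl : k = m := by omega
          rcases h3 with h3 | ⟨h4, _⟩
          · exact Or.inr h3
          · omega
      · have im : NeZero m := ⟨by omega⟩
        have iN : NeZero n := ⟨by omega⟩
        rintro (⟨⟨φ⟩⟩ | ⟨⟨φ⟩⟩)
        · exact Pregraph.TriCol.mult_bp n (by omega) φ
        · exact Pregraph.TriCol.mult_oc m φ
    · have im : NeZero m := ⟨by omega⟩
      have iN : NeZero n := ⟨by omega⟩
      exact not_iso_of_card (by rw [card_bp, card_oc]; omega)
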